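/- Let d ≥ 2, q ≥ 2, α > d, J > 0, and let φ : ZMod q → ℝ satisfy φ(0) > φ(n) for every n ≠ 0. Assume in addition that every Fourier coefficient φ̂(k) of φ is a nonnegative real number. Then there exists β₀ > 0 such that for every β > β₀ and every r ∈ ZMod q the net of finite-volume Gibbs measures Λ ↦ μ^r_{Λ,β} (indexed by finite subsets of ℤ^d directed by inclusion) converges in the topology of weak convergence on Borel probability measures on Ω = (ℤ^d → ZMod q) to a limit μ^r_β, and μ^r_β ≠ μ^ℓ_β whenever r ≠ ℓ. -/

import Mathlib

open scoped BigOperators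
open Filter MeasureTheory

noncomputable section

abbrev Zd (d : ℕ) := Fin d → ℤ
def l1 {d : ℕ} (x : Zd d) : ℤ := ∑ i, |x i|
noncomputable def Jcoup (d : ℕ) (J α : ℝ) (x y : Zd d) : ℝ :=
  if x = y then 0 else J / ((l1 (x - y) : ℝ) ^ α)
def extendCfg {d q : ℕ} (Λ : Finset (Zd d)) (η : Zd d → ZMod q) (σ : Λ → ZMod q) :
    Zd d → ZMod q :=
  fun x => if hx : x ∈ Λ then σ ⟨x, hx⟩ else η x
noncomputable def ham (d q : ℕ) (J α : ℝ) (φ : ZMod q → ℝ) (Λ : Finset (Zd d))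
    (r : ZMod q) (σ : Zd d → ZMod q) : ℝ :=
  -(1 / 2) * (∑ x ∈ Λ, ∑ y ∈ Λ, Jcoup d J α x y * φ (σ x - σ y))
    - ∑ x ∈ Λ, ∑' y : Zd d, (if y ∈ Λ then 0 else Jcoup d J α x y * φ (σ x - r))

/-- Gibbs weight of `σ` (probability of `σ` under `μ^r_{Λ,β}`). -/
noncomputable def gibbsWeight (d q : ℕ) [NeZero q] (J α β : ℝ) (φ : ZMod q → ℝ)
    (Λ : Finset (Zd d)) (r : ZMod q) (σ : Λ → ZMod q) : ℝ :=
  Real.exp (-(β * ham d q J α φ Λ r (extendCfg Λ (fun _ => r) σ)))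
    / ∑ ω : Λ → ZMod q, Real.exp (-(β * ham d q J α φ Λ r (extendCfg Λ (fun _ => r) ω)))

lemma gibbsWeight_sum (d q : ℕ) [NeZero q] (J α β : ℝ) (φ : ZMod q → ℝ)
    (Λ : Finset (Zd d)) (r : ZMod q) :
    ∑ σ : Λ → ZMod q, gibbsWeight d q J α β φ Λ r σ = 1 := by
  have hZ : 0 < ∑ ω : Λ → ZMod q,
      Real.exp (-(β * ham d q J α φ Λ r (extendCfg Λ (fun _ => r) ω))) :=
    Finset.sum_pos (fun _ _ => Real.exp_pos _) Finset.univ_nonempty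
  simp only [gibbsWeight, ← Finset.sum_div]
  exact div_self hZ.ne'

/-- The finite-volume Gibbs measure `μ^r_{Λ,β}`, as a Borel probability measure on
`Ω = (ℤ^d → ZMod q)` supported on `Ω_Λ^r`. -/
noncomputable def gibbsPM (d q : ℕ) [NeZero q] (J α β : ℝ) (φ : ZMod q → ℝ)
    (Λ : Finset (Zd d)) (r : ZMod q) : ProbabilityMeasure (Zd d → ZMod q) :=
  ⟨∑ σ : Λ → ZMod q, (ENNReal.ofReal (gibbsWeight d q J α β φ Λ r σ)) •
      Measure.dirac (extendCfg Λ (fun _ => r) σ), by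
    constructor
    rw [Measure.coe_finset_sum]
    simp only [Finset.sum_apply, Measure.smul_apply, smul_eq_mul, measure_univ, mul_one]
    rw [← ENNReal.ofReal_sum_of_nonneg (fun σ _ => by unfold gibbsWeight; positivity), gibbsWeight_sum,
      ENNReal.ofReal_one]⟩

/-- The `k`-th Fourier coefficient of `f : ZMod q → ℝ`. -/
noncomputable def ftZMod {q : ℕ} [NeZero q] (f : ZMod q → ℝ) (k : ZMod q) : ℂ :=
  ∑ n : ZMod q, (f n : ℂ) *
    Complex.exp (-(2 * (Real.pi : ℂ) * Complex.I * ((k.val * n.val : ℕ) : ℂ)) / (q : ℂ))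

section Ginibre

open Topology

/-- The kernels on `G × G` of the form `(θ, η) ↦ h θ * h η`. -/
def rankOneKernels (G : Type*) : Submonoid (G → G → ℝ) where
  carrier := {k | ∃ h : G → ℝ, k = fun θ η => h θ * h η}
  one_mem' := ⟨fun _ => 1, by ext; simp⟩
  mul_mem' := by
    rintro _ _ ⟨h, rfl⟩ ⟨h', rfl⟩
    exact ⟨fun θ => h θ * h' θ, by ext; simp; ring⟩

/-- The closed semiring of kernels generated by the rank-one positive semidefinite ones. -/
def positiveKernels (G : Type*) : Subsemiring (G → G → ℝ) :=
  (rankOneKernels G).subsemiringClosure.topologicalClosure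

lemma sum_nonneg_of_mem_positiveKernels {G : Type*} [Fintype G] {k : G → G → ℝ}
    (hk : k ∈ positiveKernels G) :
    0 ≤ ∑ θ, ∑ η, k θ η := by
  have hcl : IsClosed {k : G → G → ℝ | 0 ≤ ∑ θ, ∑ η, k θ η} :=
    isClosed_le continuous_const (by fun_prop)
  refine closure_minimal (fun k hk => ?_) hcl hk
  rw [Submonoid.subsemiringClosure_coe] at hk
  refine AddSubmonoid.closure_induction (motive := fun k _ => 0 ≤ ∑ θ, ∑ η, k θ η) ?_ ?_ ?_ hk
  · rintro _ ⟨h, rfl⟩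
    rw [← Finset.sum_mul_sum]
    exact mul_self_nonneg _
  · simp
  · intro a b _ _ ha hb
    simp only [Pi.add_apply, Finset.sum_add_distrib]
    exact add_nonneg ha hb

lemma mul_mem_positiveKernels {G : Type*} (h : G → ℝ) :
    (fun θ η => h θ * h η) ∈ positiveKernels G :=
  subset_closure (by
    rw [Submonoid.subsemiringClosure_coe]
    exact AddSubmonoid.subset_closure ⟨h, rfl⟩)

lemma const_mem_positiveKernels {G : Type*} {a : ℝ} (ha : 0 ≤ a) :
    (fun _ _ => a) ∈ positiveKernels G := by
  have := mul_mem_positiveKernels (fun _ : G => √a)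
  simpa only [Real.mul_self_sqrt ha] using this

/-- The change of variables `(θ, η) ↦ (θ - η, θ + η + c)` acting on kernels. -/
def twist {G : Type*} [AddCommGroup G] (c : G) : (G → G → ℝ) →+* (G → G → ℝ) where
  toFun F θ η := F (θ - η) (θ + η + c)
  map_one' := rfl
  map_mul' _ _ := rfl
  map_zero' := rfl
  map_add' _ _ := rfl

/-- The functions of two replicas which become positive kernels after every twist. -/
def positivePairs (G : Type*) [AddCommGroup G] : Subsemiring (G → G → ℝ) :=
  ⨅ c : G, (positiveKernels G).comap (twist c)

lemma mem_positivePairs {G : Type*} [AddCommGroup G] {F : G → G → ℝ} :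
    F ∈ positivePairs G ↔ ∀ c, (fun θ η => F (θ - η) (θ + η + c)) ∈ positiveKernels G := by
  simp only [positivePairs, Subsemiring.mem_iInf, Subsemiring.mem_comap]
  rfl

lemma isClosed_positivePairs {G : Type*} [AddCommGroup G] :
    IsClosed (positivePairs G : Set (G → G → ℝ)) := by
  have : (positivePairs G : Set (G → G → ℝ)) =
      ⋂ c : G, (fun F : G → G → ℝ => fun θ η => F (θ - η) (θ + η + c)) ⁻¹'
        (positiveKernels G : Set (G → G → ℝ)) := by
    ext F
    simp [mem_positivePairs]
  rw [this]
  refine isClosed_iInter fun c => IsClosed.preimage (by fun_prop) ?_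
  exact Subsemiring.isClosed_topologicalClosure _

lemma sum_nonneg_of_mem_positivePairs {G : Type*} [Fintype G] [AddCommGroup G] {F : G → G → ℝ}
    (hF : F ∈ positivePairs G) :
    0 ≤ ∑ x, ∑ y, F x y := by
  have h : 0 ≤ ∑ c : G, ∑ θ : G, ∑ η : G, F (θ - η) (θ + η + c) :=
    Finset.sum_nonneg fun c _ => sum_nonneg_of_mem_positiveKernels (mem_positivePairs.1 hF c)
  have h2 : ∑ c : G, ∑ θ : G, ∑ η : G, F (θ - η) (θ + η + c)
      = Fintype.card G * ∑ x, ∑ y, F x y := by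
    rw [Finset.sum_comm]
    rw [← nsmul_eq_mul, ← Finset.card_univ, ← Finset.sum_const]
    refine Finset.sum_congr rfl fun θ _ => ?_
    rw [Finset.sum_comm]
    rw [← Equiv.sum_comp (Equiv.subLeft θ)]
    refine Finset.sum_congr rfl fun η _ => ?_
    rw [← Equiv.sum_comp (Equiv.addLeft (θ + (θ - η))) (F η)]
    simp [add_assoc]
  rw [h2] at h
  exact nonneg_of_mul_nonneg_right h (by exact_mod_cast Fintype.card_pos)

lemma const_mem_positivePairs {G : Type*} [AddCommGroup G] {a : ℝ} (ha : 0 ≤ a) :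
    (fun _ _ => a) ∈ positivePairs G :=
  mem_positivePairs.2 fun _ => const_mem_positiveKernels ha

lemma exp_mem_positivePairs {G : Type*} [AddCommGroup G] {F : G → G → ℝ}
    (hF : F ∈ positivePairs G) :
    (fun x y => Real.exp (F x y)) ∈ positivePairs G := by
  refine isClosed_positivePairs.mem_of_tendsto
    (f := fun n : ℕ => fun x y => (1 + F x y / n) ^ n) (b := atTop) ?_ ?_
  · exact tendsto_pi_nhds.2 fun x => tendsto_pi_nhds.2 fun y =>
      Real.tendsto_one_add_div_pow_exp _
  · refine Eventually.of_forall fun n => ?_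
    have h1 : (fun x y => F x y * (n : ℝ)⁻¹) ∈ positivePairs G :=
      mul_mem hF (const_mem_positivePairs (by positivity))
    exact pow_mem (add_mem (one_mem _) h1) n

/-- Ginibre's cone of ferromagnetic functions on a finite abelian group. -/
def ginibreCone (G : Type*) [AddCommGroup G] : Subsemiring (G → ℝ) where
  carrier := {f | (fun x y => f x + f y) ∈ positivePairs G ∧
    (fun x y => f x - f y) ∈ positivePairs G}
  zero_mem' := by
    have := zero_mem (positivePairs G)
    constructor <;> convert this using 2 <;> ext <;> simp
  one_mem' := by
    refine ⟨?_, ?_⟩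
    · convert const_mem_positivePairs (G := G) (a := 2) (by norm_num) using 3
      norm_num
    · convert zero_mem (positivePairs G) using 2
      ext; simp
  add_mem' := by
    rintro f g ⟨hf, hf'⟩ ⟨hg, hg'⟩
    refine ⟨?_, ?_⟩
    · convert add_mem hf hg using 2
      ext; simp; ring
    · convert add_mem hf' hg' using 2
      ext; simp; ring
  mul_mem' := by
    rintro f g ⟨hf, hf'⟩ ⟨hg, hg'⟩
    have hc := const_mem_positivePairs (G := G) (a := 1 / 2) (by norm_num)
    refine ⟨?_, ?_⟩
    · convert mul_mem hc (add_mem (mul_mem hf hg) (mul_mem hf' hg')) using 2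
      ext; simp; ring
    · convert mul_mem hc (add_mem (mul_mem hf hg') (mul_mem hf' hg)) using 2
      ext; simp; ring

lemma const_mem_ginibreCone {G : Type*} [AddCommGroup G] {a : ℝ} (ha : 0 ≤ a) :
    (fun _ => a) ∈ ginibreCone G := by
  refine ⟨const_mem_positivePairs (add_nonneg ha ha), ?_⟩
  simpa using const_mem_positivePairs (G := G) le_rfl

lemma const_mul_mem_ginibreCone {G : Type*} [AddCommGroup G] {a : ℝ} (ha : 0 ≤ a) {f : G → ℝ}
    (hf : f ∈ ginibreCone G) :
    (fun x => a * f x) ∈ ginibreCone G :=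
  mul_mem (const_mem_ginibreCone ha) hf

lemma isClosed_ginibreCone {G : Type*} [AddCommGroup G] :
    IsClosed (ginibreCone G : Set (G → ℝ)) := by
  have h1 : IsClosed {f : G → ℝ | (fun x y => f x + f y) ∈ positivePairs G} :=
    isClosed_positivePairs.preimage (f := fun f : G → ℝ => fun x y => f x + f y) (by fun_prop)
  have h2 : IsClosed {f : G → ℝ | (fun x y => f x - f y) ∈ positivePairs G} :=
    isClosed_positivePairs.preimage (f := fun f : G → ℝ => fun x y => f x - f y) (by fun_prop)
  exact h1.inter h2

lemma exp_mem_ginibreCone {G : Type*} [AddCommGroup G] {f : G → ℝ} (hf : f ∈ ginibreCone G) :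
    (fun x => Real.exp (f x)) ∈ ginibreCone G := by
  refine isClosed_ginibreCone.mem_of_tendsto
    (f := fun n : ℕ => fun x => (1 + f x / n) ^ n) (b := atTop) ?_ ?_
  · exact tendsto_pi_nhds.2 fun x => Real.tendsto_one_add_div_pow_exp _
  · refine Eventually.of_forall fun n => ?_
    have h1 : (fun x => f x * (n : ℝ)⁻¹) ∈ ginibreCone G :=
      mul_mem hf (const_mem_ginibreCone (by positivity))
    exact pow_mem (add_mem (one_mem _) h1) n

lemma sum_mem_ginibreCone {G : Type*} [AddCommGroup G] {ι : Type*} (s : Finset ι) {f : ι → G → ℝ}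
    (hf : ∀ i ∈ s, f i ∈ ginibreCone G) : (fun x => ∑ i ∈ s, f i x) ∈ ginibreCone G := by
  convert sum_mem hf using 1
  ext x
  simp

lemma prod_mem_ginibreCone {G : Type*} [AddCommGroup G] {ι : Type*} (s : Finset ι) {f : ι → G → ℝ}
    (hf : ∀ i ∈ s, f i ∈ ginibreCone G) : (fun x => ∏ i ∈ s, f i x) ∈ ginibreCone G := by
  convert prod_mem hf using 1
  ext x
  simp

/-- **Ginibre's inequality** for the weight `exp K`. -/
lemma ginibre_inequality {G : Type*} [Fintype G] [AddCommGroup G] {K f g : G → ℝ}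
    (hK : K ∈ ginibreCone G) (hf : f ∈ ginibreCone G)
    (hg : g ∈ ginibreCone G) :
    (∑ x, Real.exp (K x) * f x) * (∑ x, Real.exp (K x) * g x) ≤
      (∑ x, Real.exp (K x)) * ∑ x, Real.exp (K x) * (f x * g x) := by
  have h := sum_nonneg_of_mem_positivePairs
    (mul_mem (exp_mem_positivePairs hK.1) (mul_mem hf.2 hg.2))
  have e : ∀ x y, ((fun x y => Real.exp (K x + K y)) * ((fun x y => f x - f y) *
      fun x y => g x - g y) : G → G → ℝ) x y =
      Real.exp (K x) * (f x * g x) * Real.exp (K y) + Real.exp (K x) * (Real.exp (K y) *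
      (f y * g y)) - Real.exp (K x) * f x * (Real.exp (K y) * g y) -
        Real.exp (K x) * g x * (Real.exp (K y) * f y) := by
    intro x y
    simp only [Pi.mul_apply, Real.exp_add]
    ring
  simp only [e, Finset.sum_add_distrib, Finset.sum_sub_distrib, ← Finset.sum_mul_sum] at h
  linarith

lemma re_addChar_mem_ginibreCone {G : Type*} [AddCommGroup G] (ψ : AddChar G Circle) :
    (fun x => (ψ x : ℂ).re) ∈ ginibreCone G := by
  have key : ∀ c : G, ∃ s : ℂ, s * s = ψ c ∧ s * (starRingEnd ℂ) s = 1 := by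
    intro c
    refine ⟨Circle.exp ((ψ c : ℂ).arg / 2), ?_, ?_⟩
    · rw [← Circle.coe_mul, ← Circle.exp_add, add_halves, Circle.exp_arg]
    · rw [← Circle.coe_inv_eq_conj, ← Circle.coe_mul]
      simp
  have main : ∀ c : G, ∃ s : ℂ, ∀ θ η : G,
      (ψ (θ - η) : ℂ) = (s * ψ θ) * (starRingEnd ℂ) (s * ψ η) ∧
      (ψ (θ + η + c) : ℂ) = (s * ψ θ) * (s * ψ η) := by
    intro c
    obtain ⟨s, hs, hs'⟩ := key c
    refine ⟨s, fun θ η => ⟨?_, ?_⟩⟩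
    · rw [sub_eq_add_neg, AddChar.map_add_eq_mul, AddChar.map_neg_eq_inv, Circle.coe_mul,
        Circle.coe_inv_eq_conj, map_mul]
      linear_combination (-(ψ θ : ℂ) * (starRingEnd ℂ) (ψ η)) * hs'
    · rw [AddChar.map_add_eq_mul, AddChar.map_add_eq_mul, Circle.coe_mul, Circle.coe_mul, ← hs]
      ring
  refine ⟨mem_positivePairs.2 fun c => ?_, mem_positivePairs.2 fun c => ?_⟩ <;>
    obtain ⟨s, hs⟩ := main c
  · convert mul_mem (const_mem_positiveKernels (G := G) (a := 2) (by norm_num))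
      (mul_mem_positiveKernels fun θ => (s * ψ θ).re) using 1
    ext θ η
    beta_reduce
    rw [(hs θ η).1, (hs θ η).2, Complex.mul_re (s * ψ θ), Complex.mul_re (s * ψ θ)]
    simp only [Complex.conj_re, Complex.conj_im, Pi.mul_apply]
    ring
  · convert mul_mem (const_mem_positiveKernels (G := G) (a := 2) (by norm_num))
      (mul_mem_positiveKernels fun θ => (s * ψ θ).im) using 1
    ext θ η
    beta_reduce
    rw [(hs θ η).1, (hs θ η).2, Complex.mul_re (s * ψ θ), Complex.mul_re (s * ψ θ)]
    simp only [Complex.conj_re, Complex.conj_im, Pi.mul_apply]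
    ring

end Ginibre

section Fourier

open ZMod

lemma ftZMod_eq_dft {q : ℕ} [NeZero q] (f : ZMod q → ℝ) (k : ZMod q) :
    ftZMod f k = dft (fun n => (f n : ℂ)) k := by
  rw [dft_apply, ftZMod]
  refine Finset.sum_congr rfl fun n _ => ?_
  have h : -(n * k) = ((-(k.val * n.val : ℕ) : ℤ) : ZMod q) := by
    push_cast
    simp [mul_comm]
  rw [h, stdAddChar_coe, smul_eq_mul, mul_comm]
  congr 2
  push_cast
  ring

lemma eq_sum_re_toCircle {q : ℕ} [NeZero q] {f : ZMod q → ℝ}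
    (hf : ∀ k, (ftZMod f k).im = 0) (n : ZMod q) :
    f n = ∑ k, (ftZMod f k).re / q * ((toCircle (k * n) : Circle) : ℂ).re := by
  have h1 : dft.symm (dft (fun n => (f n : ℂ))) n = (f n : ℂ) := by
    rw [LinearEquiv.symm_apply_apply]
  rw [invDFT_apply] at h1
  have h2 := congrArg Complex.re h1
  rw [Complex.ofReal_re] at h2
  rw [← h2, smul_eq_mul, Finset.mul_sum, Complex.re_sum]
  refine Finset.sum_congr rfl fun k _ => ?_
  rw [← ftZMod_eq_dft, stdAddChar_apply, smul_eq_mul]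
  have h3 : ((q : ℂ))⁻¹ = (((q : ℝ)⁻¹ : ℝ) : ℂ) := by push_cast; rfl
  rw [h3, Complex.re_ofReal_mul, Complex.mul_re, hf k]
  ring

lemma even_of_ftZMod_im_eq_zero {q : ℕ} [NeZero q] {f : ZMod q → ℝ}
    (hf : ∀ k, (ftZMod f k).im = 0) (n : ZMod q) : f (-n) = f n := by
  rw [eq_sum_re_toCircle hf, eq_sum_re_toCircle hf n]
  refine Finset.sum_congr rfl fun k _ => ?_
  rw [mul_neg, AddChar.map_neg_eq_inv, Circle.coe_inv_eq_conj, Complex.conj_re]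

lemma comp_mem_ginibreCone {q : ℕ} [NeZero q] {f : ZMod q → ℝ}
    (hf : ∀ k, 0 ≤ (ftZMod f k).re ∧ (ftZMod f k).im = 0) {G : Type*} [AddCommGroup G]
    (L : G →+ ZMod q) : (fun x => f (L x)) ∈ ginibreCone G := by
  have h : (fun x => f (L x)) = fun x => ∑ k, (ftZMod f k).re / q *
      (((toCircle.compAddMonoidHom ((AddMonoidHom.mulLeft k).comp L)) x : Circle) : ℂ).re := by
    ext x
    exact eq_sum_re_toCircle (fun k => (hf k).2) _
  rw [h]
  exact sum_mem_ginibreCone _ fun k _ =>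
    const_mul_mem_ginibreCone (div_nonneg (hf k).1 (by positivity)) (re_addChar_mem_ginibreCone _)

lemma ftZMod_nonneg_of_dominant {q : ℕ} [NeZero q] {f : ZMod q → ℝ} (hf : ∀ n, 0 ≤ f n)
    (heven : ∀ n, f (-n) = f n) (h0 : ∑ n ∈ Finset.univ.erase 0, f n ≤ f 0) (k : ZMod q) :
    0 ≤ (ftZMod f k).re ∧ (ftZMod f k).im = 0 := by
  rw [ftZMod_eq_dft, dft_apply]
  constructor
  · rw [Complex.re_sum, ← Finset.add_sum_erase _ _ (Finset.mem_univ (0 : ZMod q))]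
    have h1 : ∀ n : ZMod q, -f n ≤ (stdAddChar (-(n * k)) • (f n : ℂ)).re := by
      intro n
      have := Complex.abs_re_le_norm (stdAddChar (-(n * k)) • (f n : ℂ))
      rw [norm_smul, stdAddChar_apply, Circle.norm_coe, one_mul, Complex.norm_real,
        Real.norm_of_nonneg (hf n)] at this
      exact (abs_le.1 this).1
    have h2 := Finset.sum_le_sum fun n (_ : n ∈ Finset.univ.erase (0 : ZMod q)) => h1 n
    rw [Finset.sum_neg_distrib] at h2
    simp only [zero_mul, neg_zero, AddChar.map_zero_eq_one, one_smul, Complex.ofReal_re]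
    linarith
  · rw [← Complex.conj_eq_iff_im, map_sum, ← Equiv.sum_comp (Equiv.neg (ZMod q))]
    refine Finset.sum_congr rfl fun n _ => ?_
    rw [smul_eq_mul, smul_eq_mul, map_mul, Complex.conj_ofReal, Equiv.neg_apply, heven,
      stdAddChar_apply, stdAddChar_apply, ← Circle.coe_inv_eq_conj, ← AddChar.map_neg_eq_inv]
    simp

end Fourier

section Contours

/-- Edges of the square lattice: `(z, false)` joins `z` to `z + (1, 0)` and `(z, true)` joins
`z` to `z + (0, 1)`. -/
abbrev SquareEdge := (ℤ × ℤ) × Bool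

/-- The second endpoint of an edge. -/
def SquareEdge.target (e : SquareEdge) : ℤ × ℤ :=
  if e.2 then (e.1.1, e.1.2 + 1) else (e.1.1 + 1, e.1.2)

/-- The indicator function of a set of edges, modulo `2`. -/
def edgeParity (γ : Finset SquareEdge) (e : SquareEdge) : ZMod 2 := if e ∈ γ then 1 else 0

/-- A set of edges is a dual cycle if it meets every plaquette an even number of times. -/
def IsDualCycle (γ : Finset SquareEdge) : Prop :=
  ∀ x y : ℤ, edgeParity γ ((x, y), false) + edgeParity γ ((x + 1, y), true) +
    edgeParity γ ((x, y + 1), false) + edgeParity γ ((x, y), true) = 0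

/-- The number modulo `2` of edges of `γ` on the horizontal ray issued from `z`. -/
def rayParity (γ : Finset SquareEdge) (z : ℤ × ℤ) : ZMod 2 :=
  ∑ e ∈ γ, if e.2 = false ∧ e.1.2 = z.2 ∧ z.1 ≤ e.1.1 then 1 else 0

/-- The edges joining `A` to its complement. -/
def edgeBoundary (A : Finset (ℤ × ℤ)) : Finset SquareEdge :=
  ((A ∪ A.image (fun z => (z.1 - 1, z.2)) ∪ A.image (fun z => (z.1, z.2 - 1))) ×ˢ
    Finset.univ).filter fun e => ¬ (e.1 ∈ A ↔ e.target ∈ A)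

lemma mem_edgeBoundary {A : Finset (ℤ × ℤ)} {e : SquareEdge} :
    e ∈ edgeBoundary A ↔ ¬ (e.1 ∈ A ↔ e.target ∈ A) := by
  simp only [edgeBoundary, Finset.mem_filter, and_iff_right_iff_imp, Finset.mem_product,
    Finset.mem_univ, and_true, Finset.mem_union, Finset.mem_image]
  intro h
  by_cases h1 : e.1 ∈ A
  · exact Or.inl (Or.inl h1)
  · have h2 : e.target ∈ A := by tauto
    obtain ⟨⟨x, y⟩, b⟩ := e
    cases b
    · exact Or.inl (Or.inr ⟨_, h2, by simp [SquareEdge.target]⟩)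
    · exact Or.inr ⟨_, h2, by simp [SquareEdge.target]⟩

lemma edgeParity_edgeBoundary (A : Finset (ℤ × ℤ)) (e : SquareEdge) :
    edgeParity (edgeBoundary A) e =
      (if e.1 ∈ A then 1 else 0) + (if e.target ∈ A then 1 else 0) := by
  rw [edgeParity, if_congr mem_edgeBoundary rfl rfl]
  by_cases h1 : e.1 ∈ A <;> by_cases h2 : e.target ∈ A <;> simp [h1, h2]
  exact (CharTwo.add_self_eq_zero (1 : ZMod 2)).symm

lemma isDualCycle_edgeBoundary (A : Finset (ℤ × ℤ)) : IsDualCycle (edgeBoundary A) := by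
  intro x y
  simp only [edgeParity_edgeBoundary, SquareEdge.target]
  simp only [Bool.false_eq_true, if_false, if_true]
  generalize (if (x, y) ∈ A then (1 : ZMod 2) else 0) = a
  generalize (if (x + 1, y) ∈ A then (1 : ZMod 2) else 0) = b
  generalize (if (x, y + 1) ∈ A then (1 : ZMod 2) else 0) = c
  generalize (if (x + 1, y + 1) ∈ A then (1 : ZMod 2) else 0) = d
  revert a b c d
  decide

lemma rayParity_eq_add (γ : Finset SquareEdge) (x y : ℤ) :
    rayParity γ (x, y) = rayParity γ (x + 1, y) + edgeParity γ ((x, y), false) := by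
  have h : edgeParity γ ((x, y), false) =
      ∑ e ∈ γ, if e = ((x, y), false) then (1 : ZMod 2) else 0 := by
    rw [edgeParity, Finset.sum_ite_eq']
  rw [h, rayParity, rayParity, ← Finset.sum_add_distrib]
  refine Finset.sum_congr rfl fun e _ => ?_
  obtain ⟨⟨u, v⟩, b⟩ := e
  simp only [Prod.mk.injEq]
  by_cases hb : b = false <;> by_cases hv : v = y <;> simp only [hb, hv] <;> try simp
  rcases lt_trichotomy u x with hu | hu | hu
  · rw [if_neg (by omega), if_neg (by omega), if_neg (by omega), add_zero]
  · rw [if_pos (by omega), if_neg (by omega), if_pos (by omega), zero_add]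
  · rw [if_pos (by omega), if_pos (by omega), if_neg (by omega), add_zero]

lemma exists_abs_lt_of_mem (γ : Finset SquareEdge) :
    ∃ M : ℤ, ∀ e ∈ γ, |e.1.1| < M ∧ |e.1.2| < M := by
  refine ⟨∑ e ∈ γ, (|e.1.1| + |e.1.2|) + 1, fun e he => ?_⟩
  have := Finset.single_le_sum (f := fun e : SquareEdge => |e.1.1| + |e.1.2|)
    (fun e _ => by positivity) he
  have h1 := abs_nonneg e.1.1
  have h2 := abs_nonneg e.1.2
  constructor <;> linarith

lemma rayParity_eq_zero_of_forall {γ : Finset SquareEdge} {z : ℤ × ℤ}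
    (h : ∀ e ∈ γ, e.1.2 = z.2 → e.1.1 < z.1) : rayParity γ z = 0 := by
  refine Finset.sum_eq_zero fun e he => if_neg ?_
  rintro ⟨_, h1, h2⟩
  exact absurd (h e he h1) (not_lt.2 h2)

lemma eq_zero_of_eq_succ {R : Type*} [Zero R] {f : ℤ → R} (h : ∀ x, f x = f (x + 1)) {X : ℤ}
    (hX : f X = 0) (x : ℤ) : f x = 0 := by
  have h1 : Function.Periodic f 1 := fun x => (h x).symm
  have h2 := h1.int_mul (x - X) X
  simp only [mul_one, Int.cast_id] at h2
  rw [add_sub_cancel] at h2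
  rw [h2, hX]

lemma eq_rayParity_of_horizontal {γ : Finset SquareEdge} {f : ℤ → ZMod 2} {y : ℤ}
    (h : ∀ x, f x = f (x + 1) + edgeParity γ ((x, y), false)) {M : ℤ}
    (hM : ∀ x, M ≤ x → f x = 0) (x : ℤ) : f x = rayParity γ (x, y) := by
  obtain ⟨M', hM'⟩ := exists_abs_lt_of_mem γ
  have := eq_zero_of_eq_succ (f := fun x => f x - rayParity γ (x, y)) (X := max M M') ?_ ?_ x
  · exact sub_eq_zero.1 this
  · intro x
    rw [h x, rayParity_eq_add]
    ring
  · rw [hM _ (le_max_left _ _), rayParity_eq_zero_of_forall, sub_zero]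
    intro e he _
    exact lt_of_lt_of_le ((le_abs_self _).trans_lt (hM' e he).1) (le_max_right _ _)

lemma rayParity_edgeBoundary (A : Finset (ℤ × ℤ)) (z : ℤ × ℤ) :
    rayParity (edgeBoundary A) z = if z ∈ A then 1 else 0 := by
  obtain ⟨x, y⟩ := z
  symm
  refine eq_rayParity_of_horizontal (f := fun x => if (x, y) ∈ A then 1 else 0)
    (M := ∑ z ∈ A, |z.1| + 1) ?_ ?_ x
  · intro x
    rw [edgeParity_edgeBoundary]
    simp only [SquareEdge.target, Bool.false_eq_true, if_false]
    generalize (if (x, y) ∈ A then (1 : ZMod 2) else 0) = a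
    generalize (if (x + 1, y) ∈ A then (1 : ZMod 2) else 0) = b
    revert a b
    decide
  · intro x hx
    refine if_neg fun hxA => ?_
    have := Finset.single_le_sum (f := fun z : ℤ × ℤ => |z.1|) (fun z _ => by positivity) hxA
    have h2 := le_abs_self x
    simp only at this
    linarith

lemma IsDualCycle.rayParity_add {γ : Finset SquareEdge} (hγ : IsDualCycle γ) (x y : ℤ) :
    rayParity γ (x, y) = rayParity γ (x, y + 1) + edgeParity γ ((x, y), true) := by
  obtain ⟨M, hM⟩ := exists_abs_lt_of_mem γ
  symm
  refine eq_rayParity_of_horizontal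
    (f := fun x => rayParity γ (x, y + 1) + edgeParity γ ((x, y), true)) (M := M) ?_ ?_ x
  · intro x
    have h := hγ x y
    rw [rayParity_eq_add]
    generalize rayParity γ (x + 1, y + 1) = a at *
    generalize edgeParity γ ((x, y + 1), false) = b at *
    generalize edgeParity γ ((x, y), true) = c at *
    generalize edgeParity γ ((x + 1, y), true) = d at *
    generalize edgeParity γ ((x, y), false) = e at *
    revert a b c d e
    decide
  · intro x hx
    rw [rayParity_eq_zero_of_forall, edgeParity, if_neg, zero_add]
    · intro h
      have := (hM _ h).1
      have h2 := le_abs_self x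
      simp only at this
      linarith
    · intro e he _
      exact lt_of_lt_of_le ((le_abs_self _).trans_lt (hM e he).1) hx

lemma IsDualCycle.rayParity_eq_zero_of_column {γ : Finset SquareEdge} (hγ : IsDualCycle γ)
    {x : ℤ} (h : ∀ y, ((x, y), true) ∉ γ) (y : ℤ) : rayParity γ (x, y) = 0 := by
  obtain ⟨M, hM⟩ := exists_abs_lt_of_mem γ
  refine eq_zero_of_eq_succ (f := fun y => rayParity γ (x, y)) (X := M) ?_ ?_ y
  · intro y
    rw [hγ.rayParity_add, edgeParity, if_neg (h y), add_zero]
  · refine rayParity_eq_zero_of_forall fun e he h1 => ?_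
    have h2 := (hM e he).2
    rw [h1] at h2
    exact absurd (le_abs_self M) (not_le.2 h2)

lemma IsDualCycle.mem_iff {γ : Finset SquareEdge} (hγ : IsDualCycle γ) (e : SquareEdge) :
    e ∈ γ ↔ rayParity γ e.1 ≠ rayParity γ e.target := by
  have h : rayParity γ e.1 = rayParity γ e.target + edgeParity γ e := by
    obtain ⟨⟨x, y⟩, b⟩ := e
    cases b
    · exact rayParity_eq_add γ x y
    · exact hγ.rayParity_add x y
  rw [h, edgeParity]
  split_ifs with h1 <;> simp [h1]

/-- One step of a walk on the dual lattice, whose vertices are the plaquettes. -/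
def dualStep (a : Bool × Bool) (z : ℤ × ℤ) : ℤ × ℤ :=
  match a with
  | (false, false) => (z.1 + 1, z.2)
  | (false, true) => (z.1 - 1, z.2)
  | (true, false) => (z.1, z.2 + 1)
  | (true, true) => (z.1, z.2 - 1)

/-- The edge crossed by a step of a dual walk. -/
def dualCross (a : Bool × Bool) (z : ℤ × ℤ) : SquareEdge :=
  match a with
  | (false, false) => ((z.1 + 1, z.2), true)
  | (false, true) => (z, true)
  | (true, false) => ((z.1, z.2 + 1), false)
  | (true, true) => (z, false)

/-- The edges crossed by a dual walk. -/
def crossedEdges : List (Bool × Bool) → ℤ × ℤ → Finset SquareEdge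
  | [], _ => ∅
  | a :: w, z => insert (dualCross a z) (crossedEdges w (dualStep a z))

/-- The plaquettes visited by a dual walk. -/
def visited : List (Bool × Bool) → ℤ × ℤ → Finset (ℤ × ℤ)
  | [], z => {z}
  | a :: w, z => insert z (visited w (dualStep a z))

lemma start_mem_visited (w : List (Bool × Bool)) (z : ℤ × ℤ) : z ∈ visited w z := by
  cases w <;> simp [visited]

lemma exists_detour (w : List (Bool × Bool)) (z v : ℤ × ℤ) (hv : v ∈ visited w z)
    (a : Bool × Bool) : ∃ w' : List (Bool × Bool), w'.length = w.length + 2 ∧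
      crossedEdges w' z = insert (dualCross a v) (crossedEdges w z) := by
  have base : ∀ w : List (Bool × Bool), crossedEdges (a :: (a.1, !a.2) :: w) v =
      insert (dualCross a v) (crossedEdges w v) := by
    intro w
    have h1 : dualStep (a.1, !a.2) (dualStep a v) = v := by
      obtain ⟨b, c⟩ := a
      cases b <;> cases c <;> simp [dualStep]
    have h2 : dualCross (a.1, !a.2) (dualStep a v) = dualCross a v := by
      obtain ⟨b, c⟩ := a
      cases b <;> cases c <;> simp [dualStep, dualCross]
    simp only [crossedEdges]
    rw [h1, h2, Finset.insert_idem]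
  induction w generalizing z with
  | nil =>
    obtain rfl : v = z := by simpa [visited] using hv
    exact ⟨_, rfl, base []⟩
  | cons b w ih =>
    by_cases hvz : v = z
    · subst hvz
      exact ⟨_, rfl, base (b :: w)⟩
    · obtain ⟨w', h1, h2⟩ := ih (dualStep b z) (by simpa [visited, hvz] using hv)
      refine ⟨b :: w', by simp [h1], ?_⟩
      simp only [crossedEdges]
      rw [h2, Finset.insert_comm]

lemma mem_visited_of_cross_mem {w : List (Bool × Bool)} {z u : ℤ × ℤ} {a : Bool × Bool}
    (h : dualCross a u ∈ crossedEdges w z) : u ∈ visited w z := by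
  induction w generalizing z with
  | nil => simp [crossedEdges] at h
  | cons b w ih =>
    simp only [crossedEdges, Finset.mem_insert] at h
    rcases h with h | h
    · have h1 : u = z ∨ u = dualStep b z := by
        obtain ⟨x, y⟩ := u
        obtain ⟨x', y'⟩ := z
        obtain ⟨a1, a2⟩ := a
        obtain ⟨b1, b2⟩ := b
        cases a1 <;> cases a2 <;> cases b1 <;> cases b2 <;>
          simp only [dualCross, dualStep, Prod.mk.injEq, Bool.true_eq_false,
            Bool.false_eq_true, and_true, and_false] at h ⊢ <;> omega
      rcases h1 with rfl | rfl
      · exact start_mem_visited _ _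
      · exact Finset.mem_insert_of_mem (start_mem_visited _ _)
    · exact Finset.mem_insert_of_mem (ih h)

lemma isDualCycle_iff {γ : Finset SquareEdge} :
    IsDualCycle γ ↔ ∀ z, ∑ a, edgeParity γ (dualCross a z) = 0 := by
  have h : ∀ z, ∑ a, edgeParity γ (dualCross a z) = edgeParity γ ((z.1, z.2), false) +
      edgeParity γ ((z.1 + 1, z.2), true) + edgeParity γ ((z.1, z.2 + 1), false) +
      edgeParity γ ((z.1, z.2), true) := by
    intro z
    rw [Fintype.sum_prod_type]
    simp only [Fintype.sum_bool, dualCross]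
    ring
  simp only [h, IsDualCycle, Prod.forall]

lemma IsDualCycle.sdiff {γ T : Finset SquareEdge} (hγ : IsDualCycle γ) (hT : IsDualCycle T)
    (h : T ⊆ γ) : IsDualCycle (γ \ T) := by
  rw [isDualCycle_iff] at *
  intro z
  have e : ∀ e, edgeParity (γ \ T) e = edgeParity γ e - edgeParity T e := by
    intro e
    have := @h e
    by_cases h1 : e ∈ γ <;> by_cases h2 : e ∈ T <;> simp_all [edgeParity]
  simp only [e, Finset.sum_sub_distrib, hγ z, hT z, sub_zero]

lemma exists_dualWalk {γ : Finset SquareEdge} (hγ : IsDualCycle γ)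
    (hirr : ∀ T ⊆ γ, IsDualCycle T → T = ∅ ∨ T = γ) {z : ℤ × ℤ} {a : Bool × Bool}
    (hz : dualCross a z ∈ γ) :
    ∃ w : List (Bool × Bool), w.length = 2 * γ.card ∧ crossedEdges w z = γ := by
  have key : ∀ m ≤ γ.card, ∃ w : List (Bool × Bool), w.length = 2 * m ∧
      crossedEdges w z ⊆ γ ∧ (crossedEdges w z).card = m := by
    intro m
    induction m with
    | zero => exact fun _ => ⟨[], rfl, by simp [crossedEdges], rfl⟩
    | succ m ih =>
      intro hm
      obtain ⟨w, hw, hsub, hcard⟩ := ih (by omega)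
      by_cases hex : ∃ v ∈ visited w z, ∃ b, dualCross b v ∈ γ ∧ dualCross b v ∉ crossedEdges w z
      · obtain ⟨v, hv, b, hb, hb'⟩ := hex
        obtain ⟨w', h1, h2⟩ := exists_detour w z v hv b
        refine ⟨w', by omega, ?_, ?_⟩
        · rw [h2]
          exact Finset.insert_subset hb hsub
        · rw [h2, Finset.card_insert_of_notMem hb', hcard]
      · push Not at hex
        exfalso
        have hT : IsDualCycle (crossedEdges w z) := by
          rw [isDualCycle_iff] at hγ ⊢
          intro u
          by_cases hu : u ∈ visited w z
          · rw [← hγ u]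
            refine Finset.sum_congr rfl fun b _ => ?_
            exact if_congr ⟨fun h => hsub h, hex u hu b⟩ rfl rfl
          · exact Finset.sum_eq_zero fun b _ =>
              if_neg fun h => hu (mem_visited_of_cross_mem h)
        rcases hirr _ hsub hT with h | h
        · have := hex z (start_mem_visited _ _) a hz
          rw [h] at this
          simp at this
        · rw [h] at hcard
          omega
  obtain ⟨w, h1, h2, h3⟩ := key _ le_rfl
  exact ⟨w, h1, Finset.eq_of_subset_of_card_le h2 h3.ge⟩

/-- Every finite set containing the origin is surrounded by a dual cycle contained in its
boundary, of some length `n`, which a dual walk of length `2 * n` started at one of the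
plaquettes `(k, 0)` with `k < n` traverses. -/
lemma exists_contour {A : Finset (ℤ × ℤ)} (hA : (0, 0) ∈ A) :
    ∃ (n k : ℕ) (w : List (Bool × Bool)), k < n ∧ w.length = 2 * n ∧
      (crossedEdges w (k, 0)).card = n ∧ IsDualCycle (crossedEdges w (k, 0)) ∧
      crossedEdges w (k, 0) ⊆ edgeBoundary A := by
  classical
  have hne : ((edgeBoundary A).powerset.filter
      fun γ => IsDualCycle γ ∧ rayParity γ (0, 0) = 1).Nonempty := by
    refine ⟨edgeBoundary A, Finset.mem_filter.2 ⟨Finset.mem_powerset_self _,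
      isDualCycle_edgeBoundary A, ?_⟩⟩
    rw [rayParity_edgeBoundary, if_pos hA]
  obtain ⟨γ, hγ, hmin⟩ := Finset.exists_min_image _ Finset.card hne
  simp only [Finset.mem_filter, Finset.mem_powerset, and_imp] at hγ hmin
  obtain ⟨hsub, hcyc, hray⟩ := hγ
  have hirr : ∀ T ⊆ γ, IsDualCycle T → T = ∅ ∨ T = γ := by
    intro T hT hTc
    by_contra! hcon
    obtain ⟨h1, h2⟩ := hcon
    have hlt : T.card < γ.card := Finset.card_lt_card (hT.ssubset_of_ne h2)
    have hpos : 0 < T.card := Finset.card_pos.2 h1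
    have hadd : rayParity (γ \ T) (0, 0) + rayParity T (0, 0) = 1 := by
      rw [← hray]
      exact Finset.sum_sdiff hT
    have hcases : ∀ a b : ZMod 2, a + b = 1 → a = 1 ∨ b = 1 := by decide
    rcases hcases _ _ hadd with h | h
    · have := hmin (γ \ T) (Finset.sdiff_subset.trans hsub) (hcyc.sdiff hTc hT) h
      rw [Finset.card_sdiff_of_subset hT] at this
      omega
    · have := hmin T (hT.trans hsub) hTc h
      omega
  have hexit : ∃ k : ℕ, rayParity γ ((k : ℤ) + 1, 0) ≠ 1 := by
    obtain ⟨M, hM⟩ := exists_abs_lt_of_mem γ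
    refine ⟨M.toNat, ?_⟩
    rw [rayParity_eq_zero_of_forall]
    · decide
    · intro e he _
      have h1 := (le_abs_self _).trans_lt (hM e he).1
      have h2 := Int.self_le_toNat M
      simp only
      omega
  have hk := Nat.find_spec hexit
  have hk' : ∀ j ≤ Nat.find hexit, rayParity γ ((j : ℤ), 0) = 1 := by
    intro j hj
    rcases j with _ | j
    · exact hray
    · have := Nat.find_min hexit (m := j) (by omega)
      push Not at this
      exact_mod_cast this
  generalize Nat.find hexit = k at hk hk'
  have hcross : dualCross (true, true) ((k : ℤ), 0) ∈ γ := by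
    refine (hcyc.mem_iff _).2 ?_
    simp only [dualCross, SquareEdge.target, Bool.false_eq_true, if_false]
    rw [hk' k le_rfl]
    exact hk.symm
  have hcard : k < γ.card := by
    have hcol : ∀ j ∈ Finset.range (k + 1), ∃ y, (((j : ℤ), y), true) ∈ γ := by
      intro j hj
      by_contra! hcon
      have := hcyc.rayParity_eq_zero_of_column hcon 0
      rw [hk' j (by simpa [Nat.lt_succ_iff] using hj)] at this
      exact absurd this (by decide)
    choose! y hy using hcol
    have := Finset.card_le_card_of_injOn (s := Finset.range (k + 1)) (t := γ)
      (fun j => (((j : ℤ), y j), true)) hy (by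
        intro i _ j _ hij
        simp only [Prod.mk.injEq] at hij
        exact_mod_cast hij.1.1)
    rw [Finset.card_range] at this
    omega
  obtain ⟨w, hw, hwγ⟩ := exists_dualWalk hcyc hirr hcross
  exact ⟨γ.card, k, w, hcard, hw, by rw [hwγ], by rwa [hwγ], by rwa [hwγ]⟩

/-- The region surrounded by a dual cycle in the boundary of `A` stays in every square
containing `A`. -/
lemma rayParity_eq_zero_of_notMem_square {A : Finset (ℤ × ℤ)} {N : ℤ}
    (hA : ∀ z ∈ A, |z.1| ≤ N ∧ |z.2| ≤ N) {γ : Finset SquareEdge} (hγ : IsDualCycle γ)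
    (hsub : γ ⊆ edgeBoundary A) {z : ℤ × ℤ} (hz : ¬ (|z.1| ≤ N ∧ |z.2| ≤ N)) :
    rayParity γ z = 0 := by
  have hmem : ∀ e ∈ γ, e.1 ∈ A ∨ e.target ∈ A := by
    intro e he
    have := mem_edgeBoundary.1 (hsub he)
    tauto
  obtain ⟨x, y⟩ := z
  simp only [abs_le] at hz hA
  by_cases hx : -N ≤ x
  · have hout : ∀ e ∈ γ, e.2 = false → e.1.2 = y → e.1.1 < x := by
      rintro ⟨⟨u, v⟩, b⟩ he rfl h0
      simp only at h0
      have h1 := hmem _ he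
      simp only [SquareEdge.target, Bool.false_eq_true, if_false] at h1
      simp only
      rcases h1 with h | h <;> have h2 := hA _ h <;> simp only at h2 <;> omega
    refine Finset.sum_eq_zero fun e he => if_neg ?_
    rintro ⟨h1, h2, h3⟩
    exact absurd (hout e he h1 h2) (not_lt.2 h3)
  · refine hγ.rayParity_eq_zero_of_column (fun y' he => ?_) y
    have h1 := hmem _ he
    simp only [SquareEdge.target, if_true] at h1
    rcases h1 with h | h <;> have h2 := hA _ h <;> simp only at h2 <;> omega

end Contours

section Gibbs

lemma comp_mem_positiveKernels {G H : Type*} (L : G → H) {k : H → H → ℝ}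
    (hk : k ∈ positiveKernels H) : (fun θ η => k (L θ) (L η)) ∈ positiveKernels G := by
  refine map_mem_closure (f := fun (k : H → H → ℝ) θ η => k (L θ) (L η)) (by fun_prop) hk
    fun k hk => ?_
  rw [Submonoid.subsemiringClosure_coe] at hk ⊢
  refine AddSubmonoid.closure_induction
    (motive := fun k _ => (fun θ η => k (L θ) (L η)) ∈ AddSubmonoid.closure _) ?_ ?_ ?_ hk
  · rintro _ ⟨h, rfl⟩
    exact AddSubmonoid.subset_closure ⟨fun x => h (L x), rfl⟩
  · exact zero_mem _
  · intro _ _ _ _ h1 h2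
    exact add_mem h1 h2

lemma comp_mem_positivePairs {G H : Type*} [AddCommGroup G] [AddCommGroup H] (L : G →+ H)
    {F : H → H → ℝ} (hF : F ∈ positivePairs H) :
    (fun x y => F (L x) (L y)) ∈ positivePairs G := by
  refine mem_positivePairs.2 fun c => ?_
  simpa using comp_mem_positiveKernels L (mem_positivePairs.1 hF (L c))

lemma comp_addMonoidHom_mem_ginibreCone {G H : Type*} [AddCommGroup G] [AddCommGroup H]
    (L : G →+ H) {f : H → ℝ} (hf : f ∈ ginibreCone H) : (fun x => f (L x)) ∈ ginibreCone G :=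
  ⟨comp_mem_positivePairs L hf.1, comp_mem_positivePairs L hf.2⟩

lemma l1_neg {d : ℕ} (x : Zd d) : l1 (-x) = l1 x := by simp [l1]

lemma l1_nonneg {d : ℕ} (x : Zd d) : 0 ≤ l1 x := Finset.sum_nonneg fun _ _ => abs_nonneg _

lemma Jcoup_comm {d : ℕ} (J α : ℝ) (x y : Zd d) : Jcoup d J α x y = Jcoup d J α y x := by
  rw [Jcoup, Jcoup, ← neg_sub y x, l1_neg]
  simp only [eq_comm]

lemma Jcoup_nonneg {d : ℕ} {J : ℝ} (hJ : 0 ≤ J) (α : ℝ) (x y : Zd d) : 0 ≤ Jcoup d J α x y := by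
  have := l1_nonneg (x - y)
  rw [Jcoup]
  positivity

lemma norm_intCast_le_l1 {d : ℕ} (z : Zd d) : ‖(fun i => (z i : ℝ))‖ ≤ (l1 z : ℝ) := by
  refine (pi_norm_le_iff_of_nonneg (by exact_mod_cast l1_nonneg z)).2 fun i => ?_
  have := Finset.single_le_sum (f := fun i => |z i|) (fun _ _ => abs_nonneg _) (Finset.mem_univ i)
  rw [Real.norm_eq_abs, l1]
  exact_mod_cast this

lemma summable_l1_rpow {d : ℕ} {α : ℝ} (hα : (d : ℝ) < α) :
    Summable fun z : Zd d => (l1 z : ℝ) ^ (-α) := by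
  let b := Pi.basisFun ℝ (Fin d)
  let L := Submodule.span ℤ (Set.range b)
  have hL : Summable fun z : L => ‖z‖ ^ (-α) := by
    refine ZLattice.summable_norm_rpow L (-α) ?_
    rw [ZLattice.rank ℝ L, Module.finrank_fin_fun]
    linarith
  have hmem : ∀ z : Zd d, (fun i => (z i : ℝ)) ∈ L := fun z => by
    refine (b.mem_span_iff_repr_mem ℤ _).2 fun i => ⟨z i, ?_⟩
    simp [b]
  have hinj : Function.Injective fun z : Zd d => (⟨fun i => (z i : ℝ), hmem z⟩ : L) := by
    intro z w h
    ext i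
    have := congrFun (congrArg Subtype.val h) i
    simpa using this
  refine Summable.of_nonneg_of_le (fun z => ?_) (fun z => ?_) (hL.comp_injective hinj)
  · have : (0 : ℝ) ≤ l1 z := by exact_mod_cast l1_nonneg z
    positivity
  · rcases eq_or_ne z 0 with rfl | hz
    · have h0 : ‖(fun _ : Fin d => (0 : ℝ))‖ = 0 := norm_zero
      simp [l1, h0]
    · refine Real.rpow_le_rpow_of_nonpos ?_ (norm_intCast_le_l1 z) ?_
      · refine norm_pos_iff.2 fun h => hz ?_
        ext i
        have := congrFun (congrArg Subtype.val h) i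
        simpa using this
      · have : (0 : ℝ) ≤ d := d.cast_nonneg
        linarith

lemma summable_Jcoup {d : ℕ} (J : ℝ) {α : ℝ} (hα : (d : ℝ) < α) (x : Zd d) :
    Summable fun y => Jcoup d J α x y := by
  have h := ((Equiv.subLeft x).summable_iff.2 (summable_l1_rpow hα)).mul_left |J|
  refine Summable.of_norm_bounded h fun y => ?_
  have h0 : (0 : ℝ) ≤ l1 (x - y) := by exact_mod_cast l1_nonneg _
  rw [Jcoup]
  split_ifs
  · simp only [norm_zero, Function.comp_apply, Equiv.subLeft_apply]
    positivity
  · rw [Function.comp_apply, Equiv.subLeft_apply, Real.rpow_neg h0, norm_div, div_eq_mul_inv,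
      Real.norm_eq_abs, Real.norm_of_nonneg (by positivity)]

/-- The total coupling of `x` to the complement of `Λ`. -/
def outerField (d : ℕ) (J α : ℝ) (Λ : Finset (Zd d)) (x : Zd d) : ℝ :=
  ∑' y, if y ∈ Λ then 0 else Jcoup d J α x y

/-- The negative of the Hamiltonian in `Λ` with boundary colour `0`. -/
def energy (d : ℕ) {q : ℕ} (J α : ℝ) (φ : ZMod q → ℝ) (Λ : Finset (Zd d))
    (σ : Zd d → ZMod q) : ℝ :=
  1 / 2 * (∑ x ∈ Λ, ∑ y ∈ Λ, Jcoup d J α x y * φ (σ x - σ y)) +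
    ∑ x ∈ Λ, outerField d J α Λ x * φ (σ x)

lemma outerField_nonneg {d : ℕ} {J : ℝ} (hJ : 0 ≤ J) (α : ℝ) (Λ : Finset (Zd d)) (x : Zd d) :
    0 ≤ outerField d J α Λ x :=
  tsum_nonneg fun y => by
    have := Jcoup_nonneg hJ α x y
    positivity

lemma ham_add_const {d q : ℕ} (J α : ℝ) (φ : ZMod q → ℝ) (Λ : Finset (Zd d)) (r : ZMod q)
    (σ : Zd d → ZMod q) :
    ham d q J α φ Λ r (fun x => σ x + r) = -energy d J α φ Λ σ := by
  have h : ∀ x, (∑' y : Zd d, if y ∈ Λ then 0 else Jcoup d J α x y * φ (σ x + r - r)) =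
      outerField d J α Λ x * φ (σ x) := by
    intro x
    rw [outerField, ← tsum_mul_right]
    refine tsum_congr fun y => ?_
    split_ifs <;> simp
  simp only [ham, energy, h, add_sub_add_right_eq_sub]
  ring

lemma outerField_eq_add {d : ℕ} (J : ℝ) {α : ℝ} (hα : (d : ℝ) < α) {Λ Λ' : Finset (Zd d)}
    (h : Λ ⊆ Λ') (x : Zd d) :
    outerField d J α Λ x = outerField d J α Λ' x + ∑ y ∈ Λ' \ Λ, Jcoup d J α x y := by
  have hs : ∀ s : Finset (Zd d), Summable fun y => if y ∈ s then 0 else Jcoup d J α x y := by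
    intro s
    refine ((summable_Jcoup J hα x).indicator (sᶜ : Set (Zd d))).congr fun y => ?_
    by_cases hy : y ∈ s <;> simp [hy]
  have h2 : ∑ y ∈ Λ' \ Λ, Jcoup d J α x y =
      ∑' y, if y ∈ Λ' \ Λ then Jcoup d J α x y else 0 := by
    rw [tsum_eq_sum (s := Λ' \ Λ) fun y hy => if_neg hy]
    exact Finset.sum_congr rfl fun y hy => (if_pos hy).symm
  have hs2 : Summable fun y => if y ∈ Λ' \ Λ then Jcoup d J α x y else 0 :=
    summable_of_ne_finset_zero (s := Λ' \ Λ) fun y hy => if_neg hy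
  rw [h2, outerField, outerField, ← (hs Λ').tsum_add hs2]
  refine tsum_congr fun y => ?_
  by_cases h1 : y ∈ Λ
  · simp [h1, h h1]
  · by_cases h3 : y ∈ Λ' <;> simp [h1, h3]

lemma exists_energy_eq_add_const {d q : ℕ} (J : ℝ) {α : ℝ} (hα : (d : ℝ) < α) {φ : ZMod q → ℝ}
    (heven : ∀ n, φ (-n) = φ n) {Λ Λ' : Finset (Zd d)} (h : Λ ⊆ Λ') :
    ∃ c : ℝ, ∀ σ : Zd d → ZMod q, (∀ x ∉ Λ, σ x = 0) →
      energy d J α φ Λ' σ = energy d J α φ Λ σ + c := by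
  refine ⟨1 / 2 * (∑ x ∈ Λ' \ Λ, ∑ y ∈ Λ' \ Λ, Jcoup d J α x y * φ 0) +
    ∑ x ∈ Λ' \ Λ, outerField d J α Λ' x * φ 0, fun σ hσ => ?_⟩
  have h0 : ∀ x ∈ Λ' \ Λ, σ x = 0 := fun x hx => hσ x (Finset.mem_sdiff.1 hx).2
  have e1 : ∑ x ∈ Λ' \ Λ, ∑ y ∈ Λ' \ Λ, Jcoup d J α x y * φ (σ x - σ y) =
      ∑ x ∈ Λ' \ Λ, ∑ y ∈ Λ' \ Λ, Jcoup d J α x y * φ 0 :=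
    Finset.sum_congr rfl fun x hx => Finset.sum_congr rfl fun y hy => by
      rw [h0 x hx, h0 y hy, sub_zero]
  have e2 : ∑ x ∈ Λ, ∑ y ∈ Λ' \ Λ, Jcoup d J α x y * φ (σ x - σ y) =
      ∑ x ∈ Λ, ∑ y ∈ Λ' \ Λ, Jcoup d J α x y * φ (σ x) :=
    Finset.sum_congr rfl fun x _ => Finset.sum_congr rfl fun y hy => by
      rw [h0 y hy, sub_zero]
  have e3 : ∑ x ∈ Λ' \ Λ, ∑ y ∈ Λ, Jcoup d J α x y * φ (σ x - σ y) =
      ∑ x ∈ Λ, ∑ y ∈ Λ' \ Λ, Jcoup d J α x y * φ (σ x) := by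
    rw [Finset.sum_comm]
    refine Finset.sum_congr rfl fun x _ => Finset.sum_congr rfl fun y hy => ?_
    rw [h0 y hy, zero_sub, heven, Jcoup_comm]
  have e4 : ∑ x ∈ Λ' \ Λ, outerField d J α Λ' x * φ (σ x) =
      ∑ x ∈ Λ' \ Λ, outerField d J α Λ' x * φ 0 :=
    Finset.sum_congr rfl fun x hx => by rw [h0 x hx]
  have e5 : ∑ x ∈ Λ, outerField d J α Λ x * φ (σ x) =
      ∑ x ∈ Λ, outerField d J α Λ' x * φ (σ x) +
        ∑ x ∈ Λ, ∑ y ∈ Λ' \ Λ, Jcoup d J α x y * φ (σ x) := by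
    rw [← Finset.sum_add_distrib]
    refine Finset.sum_congr rfl fun x _ => ?_
    rw [outerField_eq_add J hα h, add_mul, Finset.sum_mul]
  simp only [energy, ← Finset.sum_sdiff h, Finset.sum_add_distrib]
  rw [e1, e2, e3, e4, e5]
  ring

/-- Extension of a configuration in `Λ` by the colour `0`. -/
def extZero {d q : ℕ} (Λ : Finset (Zd d)) : (Λ → ZMod q) →+ (Zd d → ZMod q) where
  toFun := extendCfg Λ (fun _ => 0)
  map_zero' := by ext x; simp [extendCfg]
  map_add' σ τ := by
    ext x
    by_cases hx : x ∈ Λ <;> simp [extendCfg, hx]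

lemma extZero_of_mem {d q : ℕ} {Λ : Finset (Zd d)} (σ : Λ → ZMod q) {x : Zd d} (hx : x ∈ Λ) :
    extZero Λ σ x = σ ⟨x, hx⟩ := dif_pos hx

lemma extZero_of_notMem {d q : ℕ} {Λ : Finset (Zd d)} (σ : Λ → ZMod q) {x : Zd d} (hx : x ∉ Λ) :
    extZero Λ σ x = 0 := dif_neg hx

lemma energy_mem_ginibreCone {d q : ℕ} [NeZero q] {J : ℝ} (hJ : 0 ≤ J) (α : ℝ) {φ : ZMod q → ℝ}
    (hφ : ∀ k, 0 ≤ (ftZMod φ k).re ∧ (ftZMod φ k).im = 0) (Λ : Finset (Zd d)) :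
    energy d J α φ Λ ∈ ginibreCone (Zd d → ZMod q) := by
  refine add_mem (const_mul_mem_ginibreCone (by norm_num) (sum_mem_ginibreCone _ fun x _ =>
    sum_mem_ginibreCone _ fun y _ => const_mul_mem_ginibreCone (Jcoup_nonneg hJ α x y) ?_))
    (sum_mem_ginibreCone _ fun x _ => const_mul_mem_ginibreCone (outerField_nonneg hJ α Λ x) ?_)
  · exact comp_mem_ginibreCone hφ
      (Pi.evalAddMonoidHom (fun _ => ZMod q) x - Pi.evalAddMonoidHom (fun _ => ZMod q) y)
  · exact comp_mem_ginibreCone hφ (Pi.evalAddMonoidHom (fun _ => ZMod q) x)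

lemma indicator_zero_mem_ginibreCone {d : ℕ} (q : ℕ) [NeZero q] (x : Zd d) :
    (fun σ : Zd d → ZMod q => if σ x = 0 then (1 : ℝ) else 0) ∈ ginibreCone (Zd d → ZMod q) := by
  refine comp_mem_ginibreCone (f := fun n => if n = 0 then (1 : ℝ) else 0)
    (ftZMod_nonneg_of_dominant (fun n => by positivity) (fun n => by simp) ?_)
    (Pi.evalAddMonoidHom (fun _ => ZMod q) x)
  rw [Finset.sum_eq_zero fun n hn => if_neg (Finset.ne_of_mem_erase hn)]
  simp

/-- The mean of `F` under the finite-volume Gibbs measure with boundary colour `0`. -/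
def gibbsMean (d : ℕ) {q : ℕ} [NeZero q] (J α β : ℝ) (φ : ZMod q → ℝ) (Λ : Finset (Zd d))
    (F : (Zd d → ZMod q) → ℝ) : ℝ :=
  (∑ σ : Λ → ZMod q, Real.exp (β * energy d J α φ Λ (extZero Λ σ)) * F (extZero Λ σ)) /
    ∑ σ : Λ → ZMod q, Real.exp (β * energy d J α φ Λ (extZero Λ σ))

lemma sum_extZero_eq {d q : ℕ} [NeZero q] {Λ Λ' : Finset (Zd d)} (h : Λ ⊆ Λ')
    (F : (Zd d → ZMod q) → ℝ) :
    ∑ σ : Λ' → ZMod q, F (extZero Λ' σ) *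
        ∏ x ∈ Λ' \ Λ, (if extZero Λ' σ x = 0 then 1 else 0) =
      ∑ σ : Λ → ZMod q, F (extZero Λ σ) := by
  have hext : ∀ σ : Λ → ZMod q, extZero Λ' (fun x : Λ' => extZero Λ σ x) = extZero Λ σ := by
    intro σ
    ext x
    by_cases hx : x ∈ Λ'
    · rw [extZero_of_mem _ hx]
    · rw [extZero_of_notMem _ hx, extZero_of_notMem _ fun h' => hx (h h')]
  symm
  refine Finset.sum_of_injOn (fun σ (x : Λ') => extZero Λ σ x) ?_ (fun _ _ => by simp) ?_ ?_
  · intro σ _ τ _ hst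
    ext x
    have := congrFun hst ⟨x, h x.2⟩
    simpa [extZero_of_mem] using this
  · intro ω _ hω
    by_contra hne
    refine hω ⟨fun x => ω ⟨x, h x.2⟩, by simp, ?_⟩
    have hprod := right_ne_zero_of_mul hne
    rw [Finset.prod_ne_zero_iff] at hprod
    ext ⟨x, hx⟩
    by_cases hxΛ : x ∈ Λ
    · simp [extZero_of_mem _ hxΛ]
    · have := hprod x (Finset.mem_sdiff.2 ⟨hx, hxΛ⟩)
      rw [extZero_of_mem _ hx] at this
      simp only [extZero_of_notMem _ hxΛ]
      by_contra h0
      exact this (if_neg (Ne.symm h0))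
  · intro σ _
    rw [hext, Finset.prod_eq_one, mul_one]
    intro x hx
    rw [extZero_of_notMem _ (Finset.mem_sdiff.1 hx).2, if_pos rfl]

lemma gibbsMean_anti {d q : ℕ} [NeZero q] {J α β : ℝ} (hJ : 0 ≤ J) (hα : (d : ℝ) < α)
    (hβ : 0 ≤ β) {φ : ZMod q → ℝ} (hφ : ∀ k, 0 ≤ (ftZMod φ k).re ∧ (ftZMod φ k).im = 0)
    {F : (Zd d → ZMod q) → ℝ} (hF : F ∈ ginibreCone (Zd d → ZMod q)) :
    Antitone fun Λ => gibbsMean d J α β φ Λ F := by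
  intro Λ Λ' h
  obtain ⟨c, hc⟩ := exists_energy_eq_add_const J hα
    (even_of_ftZMod_im_eq_zero fun k => (hφ k).2) h
  have key := ginibre_inequality (G := Λ' → ZMod q)
    (comp_addMonoidHom_mem_ginibreCone (extZero Λ')
      (const_mul_mem_ginibreCone hβ (energy_mem_ginibreCone hJ α hφ Λ')))
    (comp_addMonoidHom_mem_ginibreCone (extZero Λ') hF)
    (comp_addMonoidHom_mem_ginibreCone (extZero Λ')
      (prod_mem_ginibreCone (Λ' \ Λ) fun x _ => indicator_zero_mem_ginibreCone q x))
  simp only [← mul_assoc] at key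
  rw [sum_extZero_eq h fun σ => Real.exp (β * energy d J α φ Λ' σ),
    sum_extZero_eq h fun σ => Real.exp (β * energy d J α φ Λ' σ) * F σ] at key
  have e1 : ∀ σ : Λ → ZMod q, Real.exp (β * energy d J α φ Λ' (extZero Λ σ)) =
      Real.exp (β * c) * Real.exp (β * energy d J α φ Λ (extZero Λ σ)) := by
    intro σ
    rw [hc _ fun x hx => extZero_of_notMem σ hx, ← Real.exp_add]
    ring_nf
  simp only [e1, mul_assoc, ← Finset.mul_sum] at key
  have hpos : ∀ s : Finset (Zd d),
      0 < ∑ σ : s → ZMod q, Real.exp (β * energy d J α φ s (extZero s σ)) := fun s =>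
    Finset.sum_pos (fun _ _ => Real.exp_pos _) Finset.univ_nonempty
  change gibbsMean d J α β φ Λ' F ≤ gibbsMean d J α β φ Λ F
  rw [gibbsMean, gibbsMean, div_le_div_iff₀ (hpos _) (hpos _)]
  refine le_of_mul_le_mul_left ?_ (Real.exp_pos (β * c))
  linarith

end Gibbs

section WeakLimit

open BoundedContinuousFunction ZMod

instance polishSpace_configurations (d q : ℕ) [NeZero q] : PolishSpace (Zd d → ZMod q) :=
  have : PolishSpace (ZMod q) := {}
  inferInstance

/-- The linear span of the continuous characters, as a star algebra. -/
def characterAlgebra (G : Type*) [AddCommGroup G] [TopologicalSpace G] :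
    StarSubalgebra ℂ (G →ᵇ ℂ) where
  toSubalgebra := Algebra.adjoin ℂ {f | ∃ ψ : AddChar G Circle, ∀ x, f x = (ψ x : ℂ)}
  star_mem' := by
    intro f hf
    refine Algebra.adjoin_induction (p := fun f _ => star f ∈ Algebra.adjoin ℂ _)
      ?_ ?_ ?_ ?_ hf
    · rintro f ⟨ψ, hψ⟩
      refine Algebra.subset_adjoin ⟨ψ⁻¹, fun x => ?_⟩
      rw [star_apply, hψ, AddChar.inv_apply, AddChar.map_neg_eq_inv, Circle.coe_inv_eq_conj]
      rfl
    · intro c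
      rw [← algebraMap_star_comm]
      exact Subalgebra.algebraMap_mem _ _
    · intro f g _ _ hf hg
      rw [star_add]
      exact add_mem hf hg
    · intro f g _ _ hf hg
      rw [star_mul]
      exact mul_mem hg hf

lemma characterAlgebra_induction {G : Type*} [AddCommGroup G] [TopologicalSpace G]
    {p : (G →ᵇ ℂ) → Prop} (hchar : ∀ (ψ : AddChar G Circle) f, (∀ x, f x = (ψ x : ℂ)) → p f)
    (hzero : p 0) (hadd : ∀ f g, p f → p g → p (f + g)) (hsmul : ∀ (c : ℂ) f, p f → p (c • f))
    {f : G →ᵇ ℂ} (hf : f ∈ characterAlgebra G) : p f := by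
  let S : Submonoid (G →ᵇ ℂ) :=
    { carrier := {f | ∃ ψ : AddChar G Circle, ∀ x, f x = (ψ x : ℂ)}
      one_mem' := ⟨1, fun x => by simp⟩
      mul_mem' := by
        rintro f g ⟨ψ, hψ⟩ ⟨χ, hχ⟩
        exact ⟨ψ * χ, fun x => by simp [hψ, hχ]⟩ }
  have h : f ∈ Submodule.span ℂ (S : Set (G →ᵇ ℂ)) := by
    have h2 : f ∈ Subalgebra.toSubmodule (Algebra.adjoin ℂ (S : Set (G →ᵇ ℂ))) := hf
    rwa [Algebra.adjoin_eq_span, Submonoid.closure_eq] at h2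
  refine Submodule.span_induction (p := fun f _ => p f) ?_ hzero ?_ ?_ h
  · rintro f ⟨ψ, hψ⟩
    exact hchar ψ f hψ
  · intro f g _ _
    exact hadd f g
  · intro c f _
    exact hsmul c f

/-- A measure on the space of configurations is determined by its Fourier transform. -/
lemma measure_ext_of_characters {d q : ℕ} [NeZero q] {P P' : Measure (Zd d → ZMod q)}
    [IsFiniteMeasure P] [IsFiniteMeasure P']
    (h : ∀ ψ : AddChar (Zd d → ZMod q) Circle, Continuous ψ →
      ∫ x, (ψ x : ℂ) ∂P = ∫ x, (ψ x : ℂ) ∂P') : P = P' := by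
  refine ext_of_forall_mem_subalgebra_integral_eq_of_polish
    (A := characterAlgebra (Zd d → ZMod q)) ?_ fun g hg => ?_
  · intro σ τ hne
    obtain ⟨x, hx⟩ := Function.ne_iff.1 hne
    let ψ : AddChar (Zd d → ZMod q) Circle :=
      toCircle.compAddMonoidHom (Pi.evalAddMonoidHom (fun _ => ZMod q) x)
    have hcont : Continuous fun σ => (ψ σ : ℂ) :=
      (continuous_of_discreteTopology (f := fun n : ZMod q => (toCircle n : ℂ))).comp
        (continuous_apply x)
    let f : (Zd d → ZMod q) →ᵇ ℂ := BoundedContinuousFunction.mkOfCompact ⟨_, hcont⟩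
    refine ⟨f, ⟨toContinuousMapStarₐ ℂ f, ?_, rfl⟩, fun heq => hx ?_⟩
    · exact ⟨f, Algebra.subset_adjoin ⟨ψ, fun _ => rfl⟩, rfl⟩
    · exact injective_toCircle (Subtype.ext heq)
  · refine characterAlgebra_induction (p := fun g => ∫ x, g x ∂P = ∫ x, g x ∂P') ?_ ?_ ?_ ?_ hg
    · intro ψ f hf
      simp only [hf]
      refine h ψ (Topology.IsInducing.subtypeVal.continuous_iff.2 ?_)
      exact f.continuous.congr hf
    · simp
    · intro f g hf hg
      simp only [BoundedContinuousFunction.add_apply]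
      rw [integral_add (f.integrable P) (g.integrable P), hf, hg,
        integral_add (f.integrable P') (g.integrable P')]
    · intro c f hf
      simp only [BoundedContinuousFunction.smul_apply, integral_smul, hf]

lemma exists_tendsto_of_characters {d q : ℕ} [NeZero q] {ι : Type*} {l : Filter ι} [NeBot l]
    {μ : ι → ProbabilityMeasure (Zd d → ZMod q)}
    (hre : ∀ ψ : AddChar (Zd d → ZMod q) Circle, Continuous ψ →
      ∃ c, Tendsto (fun i => ∫ x, (ψ x : ℂ).re ∂(μ i : Measure (Zd d → ZMod q))) l (nhds c))
    (him : ∀ ψ : AddChar (Zd d → ZMod q) Circle, Continuous ψ →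
      ∃ c, Tendsto (fun i => ∫ x, (ψ x : ℂ).im ∂(μ i : Measure (Zd d → ZMod q))) l (nhds c)) :
    ∃ ν, Tendsto μ l (nhds ν) := by
  obtain ⟨ν, hν⟩ := exists_clusterPt_of_compactSpace (map μ l)
  refine ⟨ν, tendsto_nhds_of_unique_mapClusterPt fun ν' hν' => ?_⟩
  have key : ∀ g : (Zd d → ZMod q) → ℝ, Continuous g →
      (∃ c, Tendsto (fun i => ∫ x, g x ∂(μ i : Measure (Zd d → ZMod q))) l (nhds c)) →
      ∫ x, g x ∂(ν' : Measure (Zd d → ZMod q)) = ∫ x, g x ∂(ν : Measure (Zd d → ZMod q)) := by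
    rintro g hg ⟨c, hc⟩
    have hG := ProbabilityMeasure.continuous_integral_boundedContinuousFunction
      (BoundedContinuousFunction.mkOfCompact ⟨g, hg⟩)
    have h : ∀ ν₀, MapClusterPt ν₀ l μ → ∫ x, g x ∂(ν₀ : Measure (Zd d → ZMod q)) = c := by
      intro ν₀ h₀
      have h2 := h₀.continuousAt_comp hG.continuousAt
      exact eq_of_nhds_neBot ((show ClusterPt _ _ from h2).mono hc)
    rw [h ν' hν', h ν hν]
  refine Subtype.ext (measure_ext_of_characters (P := (ν' : Measure (Zd d → ZMod q)))
    (P' := (ν : Measure (Zd d → ZMod q))) fun ψ hψ => ?_)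
  have hψ' : Continuous fun x => (ψ x : ℂ) := continuous_subtype_val.comp hψ
  have hint : ∀ P : ProbabilityMeasure (Zd d → ZMod q),
      Integrable (fun x => (ψ x : ℂ)) (P : Measure (Zd d → ZMod q)) := fun P =>
    (BoundedContinuousFunction.mkOfCompact ⟨_, hψ'⟩).integrable _
  have h1 := key _ (Complex.continuous_re.comp hψ') (hre ψ hψ)
  have h2 := key _ (Complex.continuous_im.comp hψ') (him ψ hψ)
  rw [← integral_re_add_im (hint ν'), ← integral_re_add_im (hint ν)]
  simp only [RCLike.re_eq_complex_re, RCLike.im_eq_complex_im]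
  simp only [Function.comp_apply] at h1 h2
  rw [h1, h2]

lemma gibbsPM_integral {d q : ℕ} [NeZero q] (J α β : ℝ) (φ : ZMod q → ℝ) (Λ : Finset (Zd d))
    (F : (Zd d → ZMod q) → ℝ) (hF : Continuous F) :
    ∫ σ, F σ ∂(gibbsPM d q J α β φ Λ 0 : Measure (Zd d → ZMod q)) =
      gibbsMean d J α β φ Λ F := by
  have hint : ∀ P : Measure (Zd d → ZMod q), IsFiniteMeasure P → Integrable F P := fun P _ =>
    (BoundedContinuousFunction.mkOfCompact ⟨_, hF⟩).integrable _
  have hham : ∀ σ : Λ → ZMod q, Real.exp (-(β * ham d q J α φ Λ 0 (extendCfg Λ (fun _ => 0) σ))) =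
      Real.exp (β * energy d J α φ Λ (extZero Λ σ)) := by
    intro σ
    have := ham_add_const J α φ Λ 0 (extZero Λ σ)
    simp only [add_zero] at this
    change Real.exp (-(β * ham d q J α φ Λ 0 (extZero Λ σ))) = _
    rw [this]
    ring_nf
  have hw : ∀ σ : Λ → ZMod q, 0 ≤ gibbsWeight d q J α β φ Λ 0 σ := fun σ => by
    unfold gibbsWeight
    positivity
  rw [gibbsPM, ProbabilityMeasure.coe_mk, integral_finsetSum_measure, gibbsMean, Finset.sum_div]
  · refine Finset.sum_congr rfl fun σ _ => ?_
    rw [integral_smul_measure, integral_dirac, ENNReal.toReal_ofReal (hw σ), gibbsWeight, hham,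
      smul_eq_mul]
    simp only [hham]
    change _ / _ * F (extZero Λ σ) = _
    ring
  · intro σ _
    exact (hint _ inferInstance).smul_measure ENNReal.ofReal_ne_top

lemma gibbsPM_eq_map {d q : ℕ} [NeZero q] (J α β : ℝ) (φ : ZMod q → ℝ) (Λ : Finset (Zd d))
    (r : ZMod q) (h : Continuous fun (σ : Zd d → ZMod q) x => σ x + r) :
    gibbsPM d q J α β φ Λ r =
      (gibbsPM d q J α β φ Λ 0).map h.measurable.aemeasurable := by
  have hext : ∀ σ : Λ → ZMod q, (fun x => extendCfg Λ (fun _ => 0) σ x + r) =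
      extendCfg Λ (fun _ => r) (σ + fun _ => r) := by
    intro σ
    ext x
    by_cases hx : x ∈ Λ <;> simp [extendCfg, hx]
  have hham : ∀ σ : Λ → ZMod q, ham d q J α φ Λ r (extendCfg Λ (fun _ => r) (σ + fun _ => r)) =
      ham d q J α φ Λ 0 (extendCfg Λ (fun _ => 0) σ) := by
    intro σ
    have h0 := ham_add_const J α φ Λ 0 (extendCfg Λ (fun _ => 0) σ)
    simp only [add_zero] at h0
    rw [← hext, ham_add_const, h0]
  have hw : ∀ σ : Λ → ZMod q, gibbsWeight d q J α β φ Λ r (σ + fun _ => r) =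
      gibbsWeight d q J α β φ Λ 0 σ := by
    intro σ
    rw [gibbsWeight, gibbsWeight, hham,
      ← Equiv.sum_comp (Equiv.addRight (fun _ : Λ => r)) fun ω => Real.exp (-(β * ham d q J α φ Λ r
        (extendCfg Λ (fun _ => r) ω)))]
    simp only [Equiv.coe_addRight, hham]
  refine Subtype.ext ?_
  change (∑ σ : Λ → ZMod q, _ • Measure.dirac _) =
    Measure.map _ (∑ σ : Λ → ZMod q, _ • Measure.dirac _)
  rw [← Measure.mapₗ_apply_of_measurable h.measurable, map_sum,
    ← Equiv.sum_comp (Equiv.addRight (fun _ : Λ => r))]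
  refine Finset.sum_congr rfl fun σ _ => ?_
  rw [Measure.mapₗ_apply_of_measurable h.measurable, Measure.map_smul,
    Measure.map_dirac' h.measurable, hext, Equiv.coe_addRight, hw]

lemma gibbsMean_neg {d q : ℕ} [NeZero q] (J α β : ℝ) {φ : ZMod q → ℝ}
    (heven : ∀ n, φ (-n) = φ n) (Λ : Finset (Zd d)) (F : (Zd d → ZMod q) → ℝ) :
    gibbsMean d J α β φ Λ (fun σ => F (-σ)) = gibbsMean d J α β φ Λ F := by
  have h : ∀ σ, energy d J α φ Λ (-σ) = energy d J α φ Λ σ := by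
    intro σ
    simp only [energy, Pi.neg_apply, heven]
    simp only [← neg_sub', heven]
  rw [gibbsMean, gibbsMean, ← Equiv.sum_comp (Equiv.neg (Λ → ZMod q))]
  simp only [Equiv.neg_apply, map_neg, h, neg_neg]

lemma exists_tendsto_gibbsPM {d q : ℕ} [NeZero q] {J α β : ℝ} (hJ : 0 ≤ J) (hα : (d : ℝ) < α)
    (hβ : 0 ≤ β) {φ : ZMod q → ℝ} (hφ : ∀ k, 0 ≤ (ftZMod φ k).re ∧ (ftZMod φ k).im = 0) :
    ∃ ν, Tendsto (fun Λ : Finset (Zd d) => gibbsPM d q J α β φ Λ 0) atTop (nhds ν) := by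
  have hcont : ∀ ψ : AddChar (Zd d → ZMod q) Circle, Continuous ψ →
      Continuous fun x => (ψ x : ℂ) := fun ψ hψ => continuous_subtype_val.comp hψ
  refine exists_tendsto_of_characters (fun ψ hψ => ?_) fun ψ hψ => ⟨0, ?_⟩
  · have h1 : Continuous fun x => (ψ x : ℂ).re := Complex.continuous_re.comp (hcont ψ hψ)
    simp only [gibbsPM_integral _ _ _ _ _ _ h1]
    refine ⟨_, tendsto_atTop_ciInf (gibbsMean_anti hJ hα hβ hφ (re_addChar_mem_ginibreCone ψ))
      ⟨-1, ?_⟩⟩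
    rintro _ ⟨Λ, rfl⟩
    beta_reduce
    rw [gibbsMean, le_div_iff₀ (Finset.sum_pos (fun _ _ => Real.exp_pos _) Finset.univ_nonempty),
      Finset.mul_sum]
    refine Finset.sum_le_sum fun σ _ => ?_
    rw [mul_comm]
    refine mul_le_mul_of_nonneg_left ?_ (Real.exp_pos _).le
    have := Complex.abs_re_le_norm (ψ (extZero Λ σ) : ℂ)
    rw [Circle.norm_coe] at this
    exact (abs_le.1 this).1
  · have h1 : Continuous fun x => (ψ x : ℂ).im := Complex.continuous_im.comp (hcont ψ hψ)
    simp only [gibbsPM_integral _ _ _ _ _ _ h1]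
    refine tendsto_const_nhds.congr fun Λ => ?_
    have h2 := gibbsMean_neg J α β (even_of_ftZMod_im_eq_zero fun k => (hφ k).2) Λ
      fun x => (ψ x : ℂ).im
    simp only [AddChar.map_neg_eq_inv, Circle.coe_inv_eq_conj, Complex.conj_im] at h2
    have h3 : gibbsMean d J α β φ Λ (fun x => -(ψ x : ℂ).im) =
        -gibbsMean d J α β φ Λ (fun x => (ψ x : ℂ).im) := by
      simp only [gibbsMean, mul_neg, Finset.sum_neg_distrib, neg_div]
    linarith

end WeakLimit

section Potts

/-- The embedding of the square lattice as the plane of the first two coordinates. -/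
def planeEmbedding (d : ℕ) (z : ℤ × ℤ) : Zd d :=
  fun i => if i.val = 0 then z.1 else if i.val = 1 then z.2 else 0

lemma planeEmbedding_injective {d : ℕ} (hd : 2 ≤ d) : Function.Injective (planeEmbedding d) := by
  intro z w h
  have h0 := congrFun h ⟨0, by omega⟩
  have h1 := congrFun h ⟨1, by omega⟩
  simp only [planeEmbedding] at h0 h1
  exact Prod.ext (by simpa using h0) (by simpa using h1)

lemma planeEmbedding_target_sub {d : ℕ} (hd : 2 ≤ d) (e : SquareEdge) :
    ∃ i : Fin d, planeEmbedding d e.target - planeEmbedding d e.1 = Pi.single i 1 := by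
  obtain ⟨⟨x, y⟩, b⟩ := e
  cases b
  · refine ⟨⟨0, by omega⟩, ?_⟩
    ext i
    rcases i with ⟨i, hi⟩
    by_cases h0 : i = 0 <;> by_cases h1 : i = 1 <;>
      simp [planeEmbedding, SquareEdge.target, h0, h1]
  · refine ⟨⟨1, by omega⟩, ?_⟩
    ext i
    rcases i with ⟨i, hi⟩
    by_cases h0 : i = 0 <;> by_cases h1 : i = 1 <;>
      simp [planeEmbedding, SquareEdge.target, h0, h1]

lemma Jcoup_edge {d : ℕ} (hd : 2 ≤ d) (J α : ℝ) (e : SquareEdge) :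
    Jcoup d J α (planeEmbedding d e.1) (planeEmbedding d e.target) = J := by
  obtain ⟨i, hi⟩ := planeEmbedding_target_sub hd e
  have h1 : l1 (Pi.single i 1 : Zd d) = 1 := by
    rw [l1, Finset.sum_eq_single i]
    · simp
    · intro j _ hj
      simp [hj]
    · simp
  have hne : planeEmbedding d e.target ≠ planeEmbedding d e.1 := by
    intro h
    rw [h, sub_self] at hi
    have := congrFun hi i
    simp at this
  rw [Jcoup_comm, Jcoup, if_neg hne, hi, h1]
  simp

/-- The nearest-neighbour Potts energy on a set of edges of the plane. -/
def pottsEnergy (d : ℕ) {q : ℕ} (a : ℝ) (E : Finset SquareEdge) (σ : Zd d → ZMod q) : ℝ :=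
  a * ∑ e ∈ E, if σ (planeEmbedding d e.1) = σ (planeEmbedding d e.target) then 1 else 0

lemma pottsEnergy_mem_ginibreCone (d q : ℕ) [NeZero q] {a : ℝ} (ha : 0 ≤ a)
    (E : Finset SquareEdge) : pottsEnergy d a E ∈ ginibreCone (Zd d → ZMod q) := by
  refine const_mul_mem_ginibreCone ha (sum_mem_ginibreCone _ fun e _ => ?_)
  have h := comp_addMonoidHom_mem_ginibreCone
    (AddMonoidHom.pi fun _ : Zd d => (Pi.evalAddMonoidHom (fun _ => ZMod q) (planeEmbedding d e.1) -
      Pi.evalAddMonoidHom (fun _ => ZMod q) (planeEmbedding d e.target)))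
    (indicator_zero_mem_ginibreCone q (0 : Zd d))
  simpa [sub_eq_zero] using h

/-- At low temperature the long-range weight is the Potts weight times an element of the
Ginibre cone. -/
lemma exists_exp_energy_eq_potts_mul {d q : ℕ} [NeZero q] (hd : 2 ≤ d) {J α β a : ℝ} (hJ : 0 ≤ J)
    (hβ : 0 ≤ β) {φ : ZMod q → ℝ} (hφ : ∀ k, 0 ≤ (ftZMod φ k).re ∧ (ftZMod φ k).im = 0)
    (hdom : ∑ n ∈ Finset.univ.erase 0, Real.exp (β * J / 2 * φ n) ≤
      Real.exp (β * J / 2 * φ 0 - a)) {Λ : Finset (Zd d)} {E : Finset SquareEdge}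
    (hE : ∀ e ∈ E, planeEmbedding d e.1 ∈ Λ ∧ planeEmbedding d e.target ∈ Λ) :
    ∃ G ∈ ginibreCone (Zd d → ZMod q), ∀ σ,
      Real.exp (β * energy d J α φ Λ σ) = Real.exp (pottsEnergy d a E σ) * G σ := by
  let pair : SquareEdge → Zd d × Zd d := fun e => (planeEmbedding d e.1, planeEmbedding d e.target)
  have hpair : Function.Injective pair := by
    rintro ⟨z, b⟩ ⟨w, c⟩ h
    have h1 := planeEmbedding_injective hd (congrArg Prod.fst h)
    have h2 := planeEmbedding_injective hd (congrArg Prod.snd h)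
    simp only at h1
    subst h1
    cases b <;> cases c <;> simp [SquareEdge.target] at h2 ⊢
  have hsub : E.image pair ⊆ Λ ×ˢ Λ := by
    intro xy hxy
    obtain ⟨e, he, rfl⟩ := Finset.mem_image.1 hxy
    exact Finset.mem_product.2 (hE e he)
  let h : ZMod q → ℝ := fun n => β * J / 2 * φ n - if n = 0 then a else 0
  let rest : (Zd d → ZMod q) → ℝ := fun σ =>
    β / 2 * (∑ xy ∈ (Λ ×ˢ Λ) \ E.image pair, Jcoup d J α xy.1 xy.2 * φ (σ xy.1 - σ xy.2)) +
      β * ∑ x ∈ Λ, outerField d J α Λ x * φ (σ x)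
  have hrest : rest ∈ ginibreCone (Zd d → ZMod q) := by
    refine add_mem (const_mul_mem_ginibreCone (by positivity) (sum_mem_ginibreCone _ fun xy _ =>
      const_mul_mem_ginibreCone (Jcoup_nonneg hJ α _ _) ?_))
      (const_mul_mem_ginibreCone hβ (sum_mem_ginibreCone _ fun x _ =>
        const_mul_mem_ginibreCone (outerField_nonneg hJ α Λ x) ?_))
    · exact comp_mem_ginibreCone hφ
        (Pi.evalAddMonoidHom (fun _ => ZMod q) xy.1 - Pi.evalAddMonoidHom (fun _ => ZMod q) xy.2)
    · exact comp_mem_ginibreCone hφ (Pi.evalAddMonoidHom (fun _ => ZMod q) x)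
  have hexp : ∀ k, 0 ≤ (ftZMod (fun n => Real.exp (h n)) k).re ∧
      (ftZMod (fun n => Real.exp (h n)) k).im = 0 := by
    refine ftZMod_nonneg_of_dominant (fun n => (Real.exp_pos _).le) (fun n => ?_) ?_
    · simp [h, even_of_ftZMod_im_eq_zero fun k => (hφ k).2]
    · refine le_of_eq_of_le (Finset.sum_congr rfl fun n hn => ?_) (hdom.trans_eq (by simp [h]))
      simp [h, Finset.ne_of_mem_erase hn]
  refine ⟨fun σ => (∏ e ∈ E, Real.exp (h (σ (planeEmbedding d e.1) -
      σ (planeEmbedding d e.target)))) * Real.exp (rest σ), ?_, fun σ => ?_⟩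
  · refine mul_mem (prod_mem_ginibreCone _ fun e _ => ?_) (exp_mem_ginibreCone hrest)
    exact comp_mem_ginibreCone hexp (Pi.evalAddMonoidHom (fun _ => ZMod q) (planeEmbedding d e.1) -
      Pi.evalAddMonoidHom (fun _ => ZMod q) (planeEmbedding d e.target))
  · beta_reduce
    rw [← Real.exp_sum, ← Real.exp_add, ← Real.exp_add]
    congr 1
    have hsplit := Finset.sum_sdiff (f := fun xy : Zd d × Zd d =>
      Jcoup d J α xy.1 xy.2 * φ (σ xy.1 - σ xy.2)) hsub
    rw [Finset.sum_image hpair.injOn, Finset.sum_product] at hsplit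
    simp only [pair, Jcoup_edge hd, ← Finset.mul_sum] at hsplit
    simp only [energy, rest, h, ← hsplit, Finset.sum_sub_distrib, ← Finset.mul_sum, pottsEnergy,
      sub_eq_zero]
    have : ∀ e : SquareEdge, (if σ (planeEmbedding d e.1) = σ (planeEmbedding d e.target)
        then a else 0) = a * if σ (planeEmbedding d e.1) = σ (planeEmbedding d e.target)
        then 1 else 0 := fun e => by simp
    simp only [this, ← Finset.mul_sum]
    ring

end Potts

section Peierls

lemma sum_biUnion_le_sum_sum {ι κ : Type*} [DecidableEq ι] [DecidableEq κ] (s : Finset ι)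
    (t : ι → Finset κ) {f : κ → ℝ} (hf : ∀ x, 0 ≤ f x) :
    ∑ x ∈ s.biUnion t, f x ≤ ∑ i ∈ s, ∑ x ∈ t i, f x := by
  induction s using Finset.induction_on with
  | empty => simp
  | insert i s hi ih =>
    rw [Finset.biUnion_insert, Finset.sum_insert hi]
    have h := Finset.sum_union_inter (s₁ := t i) (s₂ := s.biUnion t) (f := f)
    have h2 : 0 ≤ ∑ x ∈ t i ∩ s.biUnion t, f x := Finset.sum_nonneg fun x _ => hf x
    linarith

lemma sum_contour_le {d q : ℕ} [NeZero q] (hd : 2 ≤ d) (a : ℝ) {Λ : Finset (Zd d)}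
    {E γ : Finset SquareEdge} (hγ : IsDualCycle γ) (hsub : γ ⊆ E)
    (hΛ : ∀ z, planeEmbedding d z ∉ Λ → rayParity γ z = 0) :
    ∑ σ : Λ → ZMod q with ∀ e ∈ γ, extZero Λ σ (planeEmbedding d e.1) ≠
        extZero Λ σ (planeEmbedding d e.target), Real.exp (pottsEnergy d a E (extZero Λ σ)) ≤
      q * Real.exp (-(a * γ.card / q)) *
        ∑ σ : Λ → ZMod q, Real.exp (pottsEnergy d a E (extZero Λ σ)) := by
  classical
  have hq : (0 : ℝ) < q := by exact_mod_cast Nat.pos_of_neZero q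
  let shift : ZMod q → Λ → ZMod q := fun s x =>
    if ∃ z, planeEmbedding d z = x ∧ rayParity γ z = 1 then s else 0
  have hshift : ∀ (σ : Λ → ZMod q) s z, extZero Λ (σ + shift s) (planeEmbedding d z) =
      extZero Λ σ (planeEmbedding d z) + if rayParity γ z = 1 then s else 0 := by
    intro σ s z
    by_cases hz : planeEmbedding d z ∈ Λ
    · rw [extZero_of_mem _ hz, extZero_of_mem _ hz, Pi.add_apply]
      congr 1
      refine if_congr ⟨?_, fun h => ⟨z, rfl, h⟩⟩ rfl rfl
      rintro ⟨w, hw, h⟩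
      rwa [← planeEmbedding_injective hd hw]
    · rw [extZero_of_notMem _ hz, extZero_of_notMem _ hz, hΛ z hz]
      simp
  have hedge : ∀ σ : Λ → ZMod q, (∀ e ∈ γ, extZero Λ σ (planeEmbedding d e.1) ≠
      extZero Λ σ (planeEmbedding d e.target)) → ∀ e, (∑ s, if extZero Λ (σ + shift s)
        (planeEmbedding d e.1) = extZero Λ (σ + shift s) (planeEmbedding d e.target)
          then (1 : ℝ) else 0) = q * (if extZero Λ σ (planeEmbedding d e.1) =
        extZero Λ σ (planeEmbedding d e.target) then 1 else 0) + if e ∈ γ then 1 else 0 := by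
    intro σ hσ e
    simp only [hshift]
    by_cases he : e ∈ γ
    · rw [if_neg (hσ e he), if_pos he, mul_zero, zero_add]
      have hne := (hγ.mem_iff e).1 he
      have h01 : ∀ u v : ZMod 2, u ≠ v → u = 1 ∧ ¬ v = 1 ∨ ¬ u = 1 ∧ v = 1 := by decide
      rcases h01 _ _ hne with ⟨h1, h2⟩ | ⟨h1, h2⟩
      · simp only [if_pos h1, if_neg h2, add_zero, ← eq_sub_iff_add_eq']
        simp
      · simp only [if_neg h1, if_pos h2, add_zero, ← sub_eq_iff_eq_add']
        simp
    · have heq := not_not.1 ((hγ.mem_iff e).not.1 he)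
      simp only [heq, add_left_inj, if_neg he, add_zero]
      simp
  have hsum : ∀ σ : Λ → ZMod q, (∀ e ∈ γ, extZero Λ σ (planeEmbedding d e.1) ≠
      extZero Λ σ (planeEmbedding d e.target)) →
      ∑ s, pottsEnergy d a E (extZero Λ (σ + shift s)) =
        ∑ _s : ZMod q, (pottsEnergy d a E (extZero Λ σ) + a * γ.card / q) := by
    intro σ hσ
    have hcard : (∑ e ∈ E, if e ∈ γ then (1 : ℝ) else 0) = γ.card := by
      rw [Finset.sum_ite_mem, Finset.inter_eq_right.2 hsub]
      simp
    simp only [pottsEnergy]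
    rw [← Finset.mul_sum, Finset.sum_comm, Finset.sum_congr rfl fun e _ => hedge σ hσ e,
      Finset.sum_add_distrib, ← Finset.mul_sum, hcard, Finset.sum_const, Finset.card_univ,
      ZMod.card, nsmul_eq_mul]
    field_simp
  have hle : ∀ σ : Λ → ZMod q, (∀ e ∈ γ, extZero Λ σ (planeEmbedding d e.1) ≠
      extZero Λ σ (planeEmbedding d e.target)) →
      Real.exp (pottsEnergy d a E (extZero Λ σ)) ≤ Real.exp (-(a * γ.card / q)) *
        ∑ s, Real.exp (pottsEnergy d a E (extZero Λ (σ + shift s))) := by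
    intro σ hσ
    obtain ⟨s, -, hs⟩ := Finset.exists_le_of_sum_le Finset.univ_nonempty (hsum σ hσ).ge
    refine le_trans ?_ (mul_le_mul_of_nonneg_left (Finset.single_le_sum
      (fun _ _ => (Real.exp_pos _).le) (Finset.mem_univ s)) (Real.exp_pos _).le)
    rw [← Real.exp_add, Real.exp_le_exp]
    linarith
  calc _ ≤ ∑ σ : Λ → ZMod q with ∀ e ∈ γ, extZero Λ σ (planeEmbedding d e.1) ≠
        extZero Λ σ (planeEmbedding d e.target), Real.exp (-(a * γ.card / q)) *
        ∑ s, Real.exp (pottsEnergy d a E (extZero Λ (σ + shift s))) :=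
        Finset.sum_le_sum fun σ hσ => hle σ (Finset.mem_filter.1 hσ).2
    _ ≤ ∑ σ : Λ → ZMod q, Real.exp (-(a * γ.card / q)) *
        ∑ s, Real.exp (pottsEnergy d a E (extZero Λ (σ + shift s))) :=
        Finset.sum_le_sum_of_subset_of_nonneg (Finset.filter_subset _ _) fun _ _ _ => by positivity
    _ = _ := by
        rw [← Finset.mul_sum, Finset.sum_comm]
        have h : ∀ s, ∑ σ : Λ → ZMod q, Real.exp (pottsEnergy d a E (extZero Λ (σ + shift s))) =
            ∑ σ : Λ → ZMod q, Real.exp (pottsEnergy d a E (extZero Λ σ)) := fun s =>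
          Equiv.sum_comp (Equiv.addRight (shift s)) fun σ =>
            Real.exp (pottsEnergy d a E (extZero Λ σ))
        simp only [h, Finset.sum_const, Finset.card_univ, ZMod.card, nsmul_eq_mul]
        ring

/-- The box of side `2 N + 1` centred at the origin. -/
def centredBox (d : ℕ) (N : ℤ) : Finset (Zd d) := Fintype.piFinset fun _ => Finset.Icc (-N) N

/-- The edges of the square lattice with both endpoints in the square of side `2 N + 1`. -/
def squareEdges (N : ℤ) : Finset SquareEdge :=
  ((Finset.Icc (-N) N ×ˢ Finset.Icc (-N) N) ×ˢ Finset.univ).filter fun e =>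
    |e.target.1| ≤ N ∧ |e.target.2| ≤ N

lemma mem_squareEdges {N : ℤ} {e : SquareEdge} :
    e ∈ squareEdges N ↔ (|e.1.1| ≤ N ∧ |e.1.2| ≤ N) ∧ |e.target.1| ≤ N ∧ |e.target.2| ≤ N := by
  simp [squareEdges, abs_le]

lemma planeEmbedding_mem_centredBox {d : ℕ} (hd : 2 ≤ d) {N : ℤ} {z : ℤ × ℤ} :
    planeEmbedding d z ∈ centredBox d N ↔ |z.1| ≤ N ∧ |z.2| ≤ N := by
  simp only [centredBox, Fintype.mem_piFinset, Finset.mem_Icc, ← abs_le]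
  constructor
  · intro h
    have h0 := h ⟨0, by omega⟩
    have h1 := h ⟨1, by omega⟩
    simp only [planeEmbedding] at h0 h1
    exact ⟨by simpa using h0, by simpa using h1⟩
  · rintro ⟨h0, h1⟩ i
    have := (abs_nonneg z.1).trans h0
    unfold planeEmbedding
    split_ifs <;> simpa

lemma sum_filter_origin_ne_zero_le {d q : ℕ} [NeZero q] (hd : 2 ≤ d) (a : ℝ) (N : ℕ) :
    ∑ σ : centredBox d N → ZMod q with extZero (centredBox d N) σ 0 ≠ 0,
        Real.exp (pottsEnergy d a (squareEdges (N + 1)) (extZero (centredBox d N) σ)) ≤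
      (∑ n ∈ Finset.range ((squareEdges (N + 1)).card + 1),
          n * (16 : ℝ) ^ n * (q * Real.exp (-(a * n / q)))) *
        ∑ σ : centredBox d N → ZMod q,
          Real.exp (pottsEnergy d a (squareEdges (N + 1)) (extZero (centredBox d N) σ)) := by
  classical
  set Λ := centredBox d N
  set E := squareEdges (N + 1)
  let I : Finset (Σ n : ℕ, ℕ × (Fin (2 * n) → Bool × Bool)) :=
    (Finset.range (E.card + 1)).sigma fun n => Finset.range n ×ˢ Finset.univ
  let c : (Σ n : ℕ, ℕ × (Fin (2 * n) → Bool × Bool)) → Finset SquareEdge := fun i =>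
    crossedEdges (List.ofFn i.2.2) (i.2.1, 0)
  let I' := I.filter fun i => (c i).card = i.1 ∧ IsDualCycle (c i) ∧ c i ⊆ E ∧
    ∀ z, planeEmbedding d z ∉ Λ → rayParity (c i) z = 0
  let bad : (Σ n : ℕ, ℕ × (Fin (2 * n) → Bool × Bool)) → Finset (Λ → ZMod q) := fun i =>
    Finset.univ.filter fun σ => ∀ e ∈ c i, extZero Λ σ (planeEmbedding d e.1) ≠
        extZero Λ σ (planeEmbedding d e.target)
  have hplane : planeEmbedding d (0, 0) = 0 := by
    ext i
    simp [planeEmbedding]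
  have hcover : (Finset.univ.filter fun σ : Λ → ZMod q => extZero Λ σ 0 ≠ 0) ⊆
      I'.biUnion bad := by
    intro σ hσ
    have h0 := (Finset.mem_filter.1 hσ).2
    let A : Finset (ℤ × ℤ) := (Finset.Icc (-(N : ℤ)) N ×ˢ Finset.Icc (-(N : ℤ)) N).filter fun z =>
      extZero Λ σ (planeEmbedding d z) ≠ 0
    have hAN : ∀ z ∈ A, |z.1| ≤ N ∧ |z.2| ≤ N := by
      intro z hz
      have := (Finset.mem_filter.1 hz).1
      simpa [abs_le] using this
    have hA : ∀ z, z ∈ A ↔ extZero Λ σ (planeEmbedding d z) ≠ 0 := by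
      intro z
      refine ⟨fun hz => (Finset.mem_filter.1 hz).2, fun hz => Finset.mem_filter.2 ⟨?_, hz⟩⟩
      have : planeEmbedding d z ∈ Λ := by
        by_contra hn
        exact hz (extZero_of_notMem _ hn)
      simpa [abs_le] using (planeEmbedding_mem_centredBox hd).1 this
    obtain ⟨n, k, w, hk, hw, hcard, hcyc, hsub⟩ :=
      exists_contour ((hA (0, 0)).2 (by rwa [hplane]))
    obtain ⟨w, rfl⟩ : ∃ f : Fin (2 * n) → Bool × Bool, w = List.ofFn f := by
      subst hcard
      rw [← hw]
      exact ⟨w.get, (List.ofFn_get w).symm⟩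
    have hE : crossedEdges (List.ofFn w) (k, 0) ⊆ E := by
      intro e he
      have h1 := mem_edgeBoundary.1 (hsub he)
      rw [mem_squareEdges]
      have h2 : e.1 ∈ A ∨ e.target ∈ A := by tauto
      obtain ⟨⟨x, y⟩, b⟩ := e
      rcases h2 with h2 | h2 <;> have h3 := hAN _ h2 <;> cases b <;>
        simp only [SquareEdge.target, abs_le] at h3 ⊢ <;> simp at h3 ⊢ <;> omega
    have hn : n ≤ E.card := hcard ▸ Finset.card_le_card hE
    refine Finset.mem_biUnion.2 ⟨⟨n, k, w⟩, Finset.mem_filter.2 ⟨?_, hcard, hcyc, hE, ?_⟩, ?_⟩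
    · exact Finset.mem_sigma.2 ⟨Finset.mem_range.2 (Nat.lt_succ_of_le hn),
        Finset.mem_product.2 ⟨Finset.mem_range.2 hk, Finset.mem_univ _⟩⟩
    · intro z hz
      exact rayParity_eq_zero_of_notMem_square hAN hcyc hsub
        ((planeEmbedding_mem_centredBox hd).not.1 hz)
    · refine Finset.mem_filter.2 ⟨Finset.mem_univ _, fun e he heq => ?_⟩
      refine mem_edgeBoundary.1 (hsub he) ?_
      rw [hA, hA, heq]
  set Z := ∑ σ : Λ → ZMod q, Real.exp (pottsEnergy d a E (extZero Λ σ))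
  have hZ : 0 ≤ Z := Finset.sum_nonneg fun _ _ => (Real.exp_pos _).le
  calc _ ≤ ∑ σ ∈ I'.biUnion bad, Real.exp (pottsEnergy d a E (extZero Λ σ)) :=
        Finset.sum_le_sum_of_subset_of_nonneg hcover fun _ _ _ => (Real.exp_pos _).le
    _ ≤ ∑ i ∈ I', ∑ σ ∈ bad i, Real.exp (pottsEnergy d a E (extZero Λ σ)) := by
        exact sum_biUnion_le_sum_sum _ _ fun _ => (Real.exp_pos _).le
    _ ≤ ∑ i ∈ I', q * Real.exp (-(a * i.1 / q)) * Z := by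
        refine Finset.sum_le_sum fun i hi => ?_
        obtain ⟨h1, h2, h3, h4⟩ := (Finset.mem_filter.1 hi).2
        have := sum_contour_le (q := q) hd a h2 h3 h4
        rwa [h1] at this
    _ ≤ ∑ i ∈ I, q * Real.exp (-(a * i.1 / q)) * Z :=
        Finset.sum_le_sum_of_subset_of_nonneg (Finset.filter_subset _ _) fun _ _ _ => by positivity
    _ = _ := by
        rw [Finset.sum_sigma, Finset.sum_mul]
        refine Finset.sum_congr rfl fun n _ => ?_
        simp only [Finset.sum_const, Finset.card_product, Finset.card_range, Finset.card_univ,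
          Fintype.card_pi, Fintype.card_prod, Fintype.card_bool, Finset.prod_const,
          Fintype.card_fin,
          nsmul_eq_mul, pow_mul]
        push_cast
        ring

end Peierls

section LowTemperature

lemma contour_series_le (q M : ℕ) [NeZero q] :
    ∑ n ∈ Finset.range M, n * (16 : ℝ) ^ n *
      (q * Real.exp (-(q * Real.log (256 * q) * n / q))) ≤ 1 / 4 := by
  have hq : (1 : ℝ) ≤ q := by exact_mod_cast Nat.one_le_iff_ne_zero.2 (NeZero.ne q)
  have hq0 : (0 : ℝ) < q := by linarith
  set r : ℝ := 1 / (16 * q)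
  have hr0 : 0 < r := by positivity
  have hr : r ≤ 1 / 16 := one_div_le_one_div_of_le (by norm_num) (by linarith)
  have hterm : ∀ n : ℕ, n * (16 : ℝ) ^ n * (q * Real.exp (-(q * Real.log (256 * q) * n / q))) =
      q * (n * r ^ n) := by
    intro n
    have h1 : -(q * Real.log (256 * q) * n / q) = n * -Real.log (256 * q) := by
      field_simp
    rw [h1, Real.exp_nat_mul, Real.exp_neg, Real.exp_log (by positivity)]
    have h2 : r ^ n = 16 ^ n * ((256 * q : ℝ)⁻¹) ^ n := by
      rw [← mul_pow]
      congr 1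
      simp only [r]
      field_simp
      norm_num
    rw [h2]
    ring
  simp only [hterm, ← Finset.mul_sum]
  have hs := hasSum_coe_mul_geometric_of_norm_lt_one (r := r)
    (by rw [Real.norm_of_nonneg hr0.le]; linarith)
  have h3 := sum_le_hasSum (Finset.range M) (fun n _ => by positivity) hs
  refine (mul_le_mul_of_nonneg_left h3 hq0.le).trans ?_
  have h4 : q * r = 1 / 16 := by
    simp only [r]
    field_simp
  rw [mul_div_assoc', h4, div_le_iff₀ (by nlinarith)]
  nlinarith

lemma gibbsMean_origin_ge {d q : ℕ} [NeZero q] (hd : 2 ≤ d) {J α β : ℝ} (hJ : 0 ≤ J)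
    (hα : (d : ℝ) < α) (hβ : 0 ≤ β) {φ : ZMod q → ℝ}
    (hφ : ∀ k, 0 ≤ (ftZMod φ k).re ∧ (ftZMod φ k).im = 0)
    (hdom : ∑ n ∈ Finset.univ.erase 0, Real.exp (β * J / 2 * φ n) ≤
      Real.exp (β * J / 2 * φ 0 - q * Real.log (256 * q))) (Λ : Finset (Zd d)) :
    3 / 4 ≤ gibbsMean d J α β φ Λ (fun σ => if σ 0 = 0 then 1 else 0) := by
  obtain ⟨N, hN⟩ : ∃ N : ℕ, Λ ⊆ centredBox d N := by
    refine ⟨∑ x ∈ Λ, (l1 x).toNat, fun x hx => ?_⟩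
    have h1 := Finset.single_le_sum (f := fun x : Zd d => (l1 x).toNat)
      (fun _ _ => Nat.zero_le _) hx
    have h2 := l1_nonneg x
    refine Fintype.mem_piFinset.2 fun i => Finset.mem_Icc.2 (abs_le.1 ?_)
    have h3 := Finset.single_le_sum (f := fun i => |x i|) (fun _ _ => abs_nonneg _)
      (Finset.mem_univ i)
    have h4 : |x i| ≤ l1 x := h3
    zify at h1 ⊢
    rw [Int.toNat_of_nonneg h2] at h1
    linarith
  have hF := indicator_zero_mem_ginibreCone q (0 : Zd d)
  refine le_trans ?_ (gibbsMean_anti hJ hα hβ hφ hF hN)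
  set a : ℝ := q * Real.log (256 * q)
  have ha : 0 ≤ a := by
    have hq : (1 : ℝ) ≤ q := by exact_mod_cast Nat.one_le_iff_ne_zero.2 (NeZero.ne q)
    exact mul_nonneg (by linarith) (Real.log_nonneg (by linarith))
  set Λ₀ := centredBox d N
  set E := squareEdges (N + 1)
  have hE : ∀ e ∈ E, planeEmbedding d e.1 ∈ centredBox d (N + 1) ∧
      planeEmbedding d e.target ∈ centredBox d (N + 1) := by
    intro e he
    rwa [planeEmbedding_mem_centredBox hd, planeEmbedding_mem_centredBox hd, ← mem_squareEdges]
  obtain ⟨G, hG, hexp⟩ := exists_exp_energy_eq_potts_mul hd (α := α) hJ hβ hφ hdom hE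
  have hbox : Λ₀ ⊆ centredBox d (N + 1) := fun x hx => by
    refine Fintype.mem_piFinset.2 fun i => ?_
    have := Finset.mem_Icc.1 (Fintype.mem_piFinset.1 hx i)
    exact Finset.mem_Icc.2 ⟨by linarith, by linarith⟩
  obtain ⟨c, hc⟩ := exists_energy_eq_add_const J hα
    (even_of_ftZMod_im_eq_zero fun k => (hφ k).2) hbox
  have hK : ∀ σ : Λ₀ → ZMod q, Real.exp (pottsEnergy d a E (extZero Λ₀ σ)) * G (extZero Λ₀ σ) =
      Real.exp (β * c) * Real.exp (β * energy d J α φ Λ₀ (extZero Λ₀ σ)) := by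
    intro σ
    rw [← hexp, hc _ fun x hx => extZero_of_notMem σ hx, ← Real.exp_add]
    ring_nf
  have key := ginibre_inequality (G := Λ₀ → ZMod q)
    (comp_addMonoidHom_mem_ginibreCone (extZero Λ₀) (pottsEnergy_mem_ginibreCone d q ha E))
    (comp_addMonoidHom_mem_ginibreCone (extZero Λ₀) hG)
    (comp_addMonoidHom_mem_ginibreCone (extZero Λ₀) hF)
  simp only [← mul_assoc, hK] at key
  simp only [mul_assoc, ← Finset.mul_sum] at key
  have hpeierls := sum_filter_origin_ne_zero_le (q := q) hd a N
  have hsplit := Finset.sum_filter_add_sum_filter_not Finset.univ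
    (fun σ : Λ₀ → ZMod q => extZero Λ₀ σ 0 = 0)
    fun σ => Real.exp (pottsEnergy d a E (extZero Λ₀ σ))
  set Z := ∑ σ : Λ₀ → ZMod q, Real.exp (pottsEnergy d a E (extZero Λ₀ σ))
  have hZ : 0 < Z := Finset.sum_pos (fun _ _ => Real.exp_pos _) Finset.univ_nonempty
  have hbad := hpeierls.trans (mul_le_mul_of_nonneg_right (contour_series_le q _) hZ.le)
  rw [Finset.sum_filter] at hsplit
  simp only [mul_ite, mul_one, mul_zero] at key
  have hgood : 3 / 4 * Z ≤ ∑ σ : Λ₀ → ZMod q, if extZero Λ₀ σ 0 = 0 then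
      Real.exp (pottsEnergy d a E (extZero Λ₀ σ)) else 0 := by
    linarith
  have hpos : 0 < ∑ σ : Λ₀ → ZMod q, Real.exp (β * energy d J α φ Λ₀ (extZero Λ₀ σ)) :=
    Finset.sum_pos (fun _ _ => Real.exp_pos _) Finset.univ_nonempty
  change 3 / 4 ≤ gibbsMean d J α β φ Λ₀ _
  rw [gibbsMean, le_div_iff₀ hpos]
  simp only [mul_ite, mul_one, mul_zero]
  set W := ∑ σ : Λ₀ → ZMod q, Real.exp (β * energy d J α φ Λ₀ (extZero Λ₀ σ))
  set V := ∑ σ : Λ₀ → ZMod q, if extZero Λ₀ σ 0 = 0 then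
    Real.exp (β * energy d J α φ Λ₀ (extZero Λ₀ σ)) else 0
  rw [← mul_assoc (Real.exp (β * c)) W] at key
  have hfin := (mul_le_mul_of_nonneg_left hgood
    (mul_pos (Real.exp_pos (β * c)) hpos).le).trans key
  refine le_of_mul_le_mul_left ?_ (mul_pos (Real.exp_pos (β * c)) hZ)
  linarith

lemma exists_low_temperature {q : ℕ} [NeZero q] {J : ℝ} (hJ : 0 < J) {φ : ZMod q → ℝ}
    (hφ : ∀ n : ZMod q, n ≠ 0 → φ n < φ 0) (a : ℝ) :
    ∃ β₀ : ℝ, 0 < β₀ ∧ ∀ β, β₀ < β → ∑ n ∈ Finset.univ.erase 0, Real.exp (β * J / 2 * φ n) ≤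
      Real.exp (β * J / 2 * φ 0 - a) := by
  have hq : (0 : ℝ) < q := by exact_mod_cast Nat.pos_of_neZero q
  have hev : ∀ᶠ β : ℝ in atTop, ∀ n : ZMod q, n ≠ 0 →
      Real.log q + a ≤ β * (J / 2 * (φ 0 - φ n)) := by
    refine eventually_all.2 fun n => ?_
    by_cases hn : n = 0
    · simp [hn]
    · have hpos : 0 < J / 2 * (φ 0 - φ n) := mul_pos (by positivity) (sub_pos.2 (hφ n hn))
      filter_upwards [(tendsto_id.atTop_mul_const hpos).eventually_ge_atTop (Real.log q + a)]
        with β hβ _ using hβ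
  obtain ⟨β₀, hβ₀⟩ := eventually_atTop.1 hev
  refine ⟨max β₀ 1, by positivity, fun β hβ => ?_⟩
  have h := hβ₀ β ((le_max_left _ _).trans hβ.le)
  have hle : ∀ n ∈ Finset.univ.erase (0 : ZMod q), Real.exp (β * J / 2 * φ n) ≤
      Real.exp (β * J / 2 * φ 0 - a) / q := by
    intro n hn
    rw [le_div_iff₀ hq]
    conv_lhs => rw [← Real.exp_log hq]
    rw [← Real.exp_add, Real.exp_le_exp]
    linarith [h n (Finset.ne_of_mem_erase hn)]
  refine (Finset.sum_le_sum hle).trans ?_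
  rw [Finset.sum_const, nsmul_eq_mul, mul_div_assoc', div_le_iff₀ hq, mul_comm]
  refine mul_le_mul_of_nonneg_left ?_ (Real.exp_pos _).le
  have := Finset.card_le_univ (Finset.univ.erase (0 : ZMod q))
  rw [ZMod.card] at this
  exact_mod_cast this

end LowTemperature

/-- **Existence and distinctness of the thermodynamic limits** (Corollary 1.2):
if moreover the Fourier transform of `φ` is nonnegative, then for `β` large enough
the net of finite-volume Gibbs measures with monochromatic boundary condition `r`
converges weakly, and different colours give different limits. -/
theorem thermodynamic_limits_exist_and_differ
    (d q : ℕ) (hd : 2 ≤ d) [NeZero q] (hq : 2 ≤ q)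
    (α J : ℝ) (hα : (d : ℝ) < α) (hJ : 0 < J)
    (φ : ZMod q → ℝ) (hφ : ∀ n : ZMod q, n ≠ 0 → φ n < φ 0)
    (hFourier : ∀ k : ZMod q, 0 ≤ (ftZMod φ k).re ∧ (ftZMod φ k).im = 0) :
    ∃ β₀ : ℝ, 0 < β₀ ∧ ∀ β : ℝ, β₀ < β →
      ∃ μlim : ZMod q → ProbabilityMeasure (Zd d → ZMod q),
        (∀ r : ZMod q,
          Tendsto (fun Λ : Finset (Zd d) => gibbsPM d q J α β φ Λ r) atTop (nhds (μlim r))) ∧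
        (∀ r ℓ : ZMod q, r ≠ ℓ → μlim r ≠ μlim ℓ) := by
  obtain ⟨β₀, hβ₀, hlow⟩ := exists_low_temperature hJ hφ (q * Real.log (256 * q))
  refine ⟨β₀, hβ₀, fun β hβ => ?_⟩
  have hβ0 : 0 ≤ β := (hβ₀.trans hβ).le
  obtain ⟨ν, hν⟩ := exists_tendsto_gibbsPM hJ.le hα hβ0 hFourier
  have hshift : ∀ r : ZMod q, Continuous fun (σ : Zd d → ZMod q) x => σ x + r := fun r => by
    fun_prop
  have hind : ∀ r : ZMod q, Continuous fun σ : Zd d → ZMod q => if σ 0 = r then (1 : ℝ) else 0 :=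
    fun r => (continuous_of_discreteTopology (f := fun n : ZMod q =>
      if n = r then (1 : ℝ) else 0)).comp (continuous_apply 0)
  have hmean : 3 / 4 ≤ ∫ σ, (if σ 0 = 0 then (1 : ℝ) else 0) ∂(ν : Measure (Zd d → ZMod q)) := by
    have hG := (ProbabilityMeasure.continuous_integral_boundedContinuousFunction
      (BoundedContinuousFunction.mkOfCompact ⟨_, hind 0⟩)).tendsto ν
    refine ge_of_tendsto (hG.comp hν) (Eventually.of_forall fun Λ => ?_)
    refine (gibbsMean_origin_ge hd hJ.le hα hβ0 hFourier (hlow β hβ) Λ).trans_eq ?_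
    exact (gibbsPM_integral J α β φ Λ _ (hind 0)).symm
  have hmap : ∀ r, 3 / 4 ≤ ∫ σ, (if σ 0 = r then (1 : ℝ) else 0)
      ∂(ν.map (hshift r).measurable.aemeasurable : Measure (Zd d → ZMod q)) := by
    intro r
    rw [ProbabilityMeasure.toMeasure_map, integral_map (hshift r).measurable.aemeasurable
      (hind r).aestronglyMeasurable]
    simpa using hmean
  refine ⟨fun r => ν.map (hshift r).measurable.aemeasurable, fun r => ?_, fun r ℓ hne heq => ?_⟩
  · simp only [gibbsPM_eq_map J α β φ _ r (hshift r)]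
    exact ProbabilityMeasure.tendsto_map_of_tendsto_of_continuous _ _ hν (hshift r)
  · have h1 := hmap r
    have h2 := hmap ℓ
    beta_reduce at heq
    rw [heq] at h1
    have hint : ∀ s, Integrable (fun σ : Zd d → ZMod q => if σ 0 = s then (1 : ℝ) else 0)
        (ν.map (hshift ℓ).measurable.aemeasurable : Measure (Zd d → ZMod q)) := fun s =>
      (BoundedContinuousFunction.mkOfCompact ⟨_, hind s⟩).integrable _
    have h3 := integral_mono ((hint r).add (hint ℓ)) (integrable_const (1 : ℝ)) fun σ => by
      by_cases hr : σ 0 = r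
      · simp [hr, hne]
      · by_cases hl : σ 0 = ℓ <;> simp [hl, hr, Ne.symm hne]
    simp only [Pi.add_apply] at h3
    rw [integral_add (hint r) (hint ℓ), integral_const, probReal_univ, one_smul] at h3
    linarith
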